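/- arXiv:1906.09437 — 15 statements merged into one kernel-verified Lean document; each statement's English description precedes it below -/
import Mathlib

section
/- Let E be a real inner product space, let μ > 0, L > 0, γ > 0, let B : E → E be μ-strongly monotone and L-Lipschitz, let J : E → E be nonexpansive, and let x* ∈ E satisfy J(x* − γ • B x*) = x*. Let n ≥ 1, let x ∈ E, and let g : {1,…,n} → E satisfy (1/n)∑_{i=1}^n g(i) = B x. Then (1/n)∑_{i=1}^n ‖J(x − γ • g(i)) − x*‖² ≤ (1 − 2γμ + γ²L²)‖x − x*‖² + γ² · (1/n)∑_{i=1}^n ‖g(i) − B x‖². -/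
open scoped RealInnerProductSpace

/-- One-step expected error of stochastic forward-backward splitting with an
unbiased estimator, the conditional expectation being a uniform average. -/
theorem fb_splitting_one_step_expected_error
    {E : Type*} [NormedAddCommGroup E] [InnerProductSpace ℝ E]
    (μ L γ : ℝ) (hμ : 0 < μ) (hL : 0 < L) (hγ : 0 < γ)
    (B : E → E)
    (hmono : ∀ x y : E, μ * ‖x - y‖ ^ 2 ≤ ⟪B x - B y, x - y⟫)
    (hlip : ∀ x y : E, ‖B x - B y‖ ≤ L * ‖x - y‖)
    (J : E → E) (hJ : ∀ x y : E, ‖J x - J y‖ ≤ ‖x - y‖)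
    (xstar : E) (hfix : J (xstar - γ • B xstar) = xstar)
    (n : ℕ) (hn : 1 ≤ n) (x : E) (g : Fin n → E)
    (hunbiased : (1 / (n : ℝ)) • ∑ i : Fin n, g i = B x) :
    (1 / (n : ℝ)) * ∑ i : Fin n, ‖J (x - γ • g i) - xstar‖ ^ 2 ≤
      (1 - 2 * γ * μ + γ ^ 2 * L ^ 2) * ‖x - xstar‖ ^ 2 +
        γ ^ 2 * ((1 / (n : ℝ)) * ∑ i : Fin n, ‖g i - B x‖ ^ 2) := by
  have hn0 : (0 : ℝ) < n := by exact_mod_cast hn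
  set d : E := (x - xstar) - γ • (B x - B xstar) with hd
  have hterm : ∀ i : Fin n, ‖J (x - γ • g i) - xstar‖ ^ 2 ≤
      ‖d‖ ^ 2 - 2 * γ * ⟪d, g i - B x⟫ + γ ^ 2 * ‖g i - B x‖ ^ 2 := by
    intro i
    have h1 : ‖J (x - γ • g i) - xstar‖ ≤ ‖d - γ • (g i - B x)‖ := by
      have h := hJ (x - γ • g i) (xstar - γ • B xstar)
      rw [hfix] at h
      have e : x - γ • g i - (xstar - γ • B xstar) = d - γ • (g i - B x) := by
        rw [hd]; module
      rwa [e] at h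
    have h2 : ‖d - γ • (g i - B x)‖ ^ 2 =
        ‖d‖ ^ 2 - 2 * γ * ⟪d, g i - B x⟫ + γ ^ 2 * ‖g i - B x‖ ^ 2 := by
      rw [norm_sub_sq_real, inner_smul_right, norm_smul, mul_pow, Real.norm_eq_abs, sq_abs]
      ring
    rw [← h2]
    gcongr
  have hsum0 : ∑ i : Fin n, ⟪d, g i - B x⟫ = 0 := by
    have hg : ∑ i : Fin n, g i = (n : ℝ) • B x := by
      rw [← hunbiased, smul_smul, mul_one_div_cancel hn0.ne', one_smul]
    rw [← inner_sum, Finset.sum_sub_distrib, hg]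
    simp [← Nat.cast_smul_eq_nsmul ℝ]
  have hdle : ‖d‖ ^ 2 ≤ (1 - 2 * γ * μ + γ ^ 2 * L ^ 2) * ‖x - xstar‖ ^ 2 := by
    have h1 := hmono x xstar
    have h2 : ‖B x - B xstar‖ ^ 2 ≤ (L * ‖x - xstar‖) ^ 2 := by
      gcongr
      exact hlip x xstar
    rw [hd, norm_sub_sq_real, inner_smul_right, norm_smul, mul_pow, Real.norm_eq_abs, sq_abs,
      real_inner_comm]
    have h3 := mul_le_mul_of_nonneg_left h1 hγ.le
    have h4 := mul_le_mul_of_nonneg_left h2 (sq_nonneg γ)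
    linarith
  have hsum := Finset.sum_le_sum (fun i (_ : i ∈ Finset.univ) => hterm i)
  rw [Finset.sum_add_distrib, Finset.sum_sub_distrib, ← Finset.mul_sum, ← Finset.mul_sum,
    hsum0] at hsum
  simp only [Finset.sum_const, Finset.card_univ, Fintype.card_fin, nsmul_eq_mul, mul_zero,
    sub_zero] at hsum
  calc _ ≤ (1 / (n : ℝ)) * (n * ‖d‖ ^ 2 + γ ^ 2 * ∑ i : Fin n, ‖g i - B x‖ ^ 2) := by
        gcongr
    _ = ‖d‖ ^ 2 + γ ^ 2 * ((1 / (n : ℝ)) * ∑ i : Fin n, ‖g i - B x‖ ^ 2) := by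
        field_simp
    _ ≤ _ := by gcongr
end

section
/- Let E be a real inner product space, let n ≥ 1, L > 0, let B₁, …, Bₙ : E → E each be L-Lipschitz, and let B = (1/n)∑_{i=1}^n Bᵢ. Let x, x* ∈ E and φ₁, …, φₙ ∈ E, and for each i define G(x, φ, i) = Bᵢ(x) − φᵢ + (1/n)∑_{j=1}^n φⱼ. Then (1/n)∑_{i=1}^n ‖G(x, φ, i) − B x‖² ≤ 2 ( L²‖x − x*‖² + (1/n)∑_{i=1}^n ‖φᵢ − Bᵢ(x*)‖² ). -/
open scoped RealInnerProductSpace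

theorem sum_sq_sub_mean_le {E : Type*} [NormedAddCommGroup E] [InnerProductSpace ℝ E]
    (n : ℕ) (hn : 1 ≤ n) (Y : Fin n → E) (m : E) (hm : ∑ i, Y i = (n : ℝ) • m) :
    ∑ i, ‖Y i - m‖ ^ 2 ≤ ∑ i, ‖Y i‖ ^ 2 := by
  have h1 : ∑ i, inner ℝ (Y i) m = (n : ℝ) * ‖m‖ ^ 2 := by
    rw [← sum_inner, hm, real_inner_smul_left, real_inner_self_eq_norm_sq]
  have h2 : ∑ i, ‖Y i - m‖ ^ 2 = ∑ i, ‖Y i‖ ^ 2 - 2 * ∑ i, inner ℝ (Y i) m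
      + (n : ℝ) * ‖m‖ ^ 2 := by
    simp only [norm_sub_sq_real, Finset.sum_add_distrib, Finset.sum_sub_distrib,
      Finset.mul_sum, Finset.sum_const, Finset.card_univ, Fintype.card_fin, nsmul_eq_mul]
  have h3 : 0 ≤ (n : ℝ) * ‖m‖ ^ 2 := by positivity
  rw [h2, h1]
  linarith

/-- Bound on the variance of the variance-reduced estimator
G(x, φ, i) = Bᵢ(x) − φᵢ + (1/n)∑ⱼ φⱼ over a uniformly sampled index. -/
theorem variance_reduced_estimator_variance_bound
    {E : Type*} [NormedAddCommGroup E] [InnerProductSpace ℝ E]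
    (n : ℕ) (hn : 1 ≤ n) (L : ℝ) (hL : 0 < L)
    (Bi : Fin n → E → E)
    (hlip : ∀ i : Fin n, ∀ x y : E, ‖Bi i x - Bi i y‖ ≤ L * ‖x - y‖)
    (B : E → E) (hB : ∀ x : E, B x = (1 / (n : ℝ)) • ∑ i : Fin n, Bi i x)
    (x xstar : E) (φ : Fin n → E) :
    (1 / (n : ℝ)) *
        ∑ i : Fin n, ‖(Bi i x - φ i + (1 / (n : ℝ)) • ∑ j : Fin n, φ j) - B x‖ ^ 2 ≤
      2 * (L ^ 2 * ‖x - xstar‖ ^ 2 +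
        (1 / (n : ℝ)) * ∑ i : Fin n, ‖φ i - Bi i xstar‖ ^ 2) := by
  have hn0 : (n : ℝ) ≠ 0 := by
    have : n ≠ 0 := by omega
    exact_mod_cast this
  have key := sum_sq_sub_mean_le n hn (fun i => Bi i x - φ i)
    (B x - (1 / (n : ℝ)) • ∑ j : Fin n, φ j) (by
      rw [hB, ← smul_sub, smul_smul, mul_one_div_cancel hn0, one_smul,
        Finset.sum_sub_distrib])
  have e : ∀ i, Bi i x - φ i + (1 / (n : ℝ)) • ∑ j : Fin n, φ j - B x
      = Bi i x - φ i - (B x - (1 / (n : ℝ)) • ∑ j : Fin n, φ j) := fun i => by abel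
  simp only [e]
  have hb : ∑ i, ‖Bi i x - φ i‖ ^ 2 ≤
      ∑ i, (2 * (L ^ 2 * ‖x - xstar‖ ^ 2) + 2 * ‖φ i - Bi i xstar‖ ^ 2) := by
    refine Finset.sum_le_sum fun i _ => ?_
    have t : ‖Bi i x - φ i‖ ≤ L * ‖x - xstar‖ + ‖φ i - Bi i xstar‖ := by
      have h := norm_sub_le (Bi i x - Bi i xstar) (φ i - Bi i xstar)
      rw [sub_sub_sub_cancel_right] at h
      linarith [hlip i x xstar]
    have t2 := pow_le_pow_left₀ (norm_nonneg _) t 2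
    nlinarith [sq_nonneg (L * ‖x - xstar‖ - ‖φ i - Bi i xstar‖)]
  have hfin := mul_le_mul_of_nonneg_left (key.trans hb)
    (by positivity : (0 : ℝ) ≤ 1 / (n : ℝ))
  refine hfin.trans (le_of_eq ?_)
  rw [Finset.sum_add_distrib, ← Finset.mul_sum]
  simp only [Finset.sum_const, Finset.card_univ, Fintype.card_fin, nsmul_eq_mul]
  field_simp
  rw [← Finset.mul_sum]
  ring
end

section
/- Let E be a real inner product space, let n ≥ 1, μ > 0, L > 0, γ > 0. Let B₁, …, Bₙ : E → E each be L-Lipschitz, let B = (1/n)∑_{i=1}^n Bᵢ be μ-strongly monotone, let J : E → E be nonexpansive, and let x* ∈ E satisfy J(x* − γ • B x*) = x*. Let x ∈ E and φ₁, …, φₙ ∈ E, and for each i define G(x, φ, i) = Bᵢ(x) − φᵢ + (1/n)∑_{j=1}^n φⱼ. Then (1/n)∑_{i=1}^n ‖J(x − γ • G(x, φ, i)) − x*‖² ≤ (1 − 2γμ + 3γ²L²)‖x − x*‖² + (2γ²/n)∑_{i=1}^n ‖φᵢ − Bᵢ(x*)‖². -/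
open scoped RealInnerProductSpace

/-- One-step expected error of variance-reduced forward-backward splitting. -/
theorem variance_reduced_fb_one_step_error
    {E : Type*} [NormedAddCommGroup E] [InnerProductSpace ℝ E]
    (n : ℕ) (hn : 1 ≤ n) (μ L γ : ℝ) (hμ : 0 < μ) (hL : 0 < L) (hγ : 0 < γ)
    (Bi : Fin n → E → E)
    (hlip : ∀ i : Fin n, ∀ x y : E, ‖Bi i x - Bi i y‖ ≤ L * ‖x - y‖)
    (B : E → E) (hB : ∀ x : E, B x = (1 / (n : ℝ)) • ∑ i : Fin n, Bi i x)
    (hmono : ∀ x y : E, μ * ‖x - y‖ ^ 2 ≤ ⟪B x - B y, x - y⟫)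
    (J : E → E) (hJ : ∀ x y : E, ‖J x - J y‖ ≤ ‖x - y‖)
    (xstar : E) (hfix : J (xstar - γ • B xstar) = xstar)
    (x : E) (φ : Fin n → E) :
    (1 / (n : ℝ)) *
        ∑ i : Fin n,
          ‖J (x - γ • (Bi i x - φ i + (1 / (n : ℝ)) • ∑ j : Fin n, φ j)) - xstar‖ ^ 2 ≤
      (1 - 2 * γ * μ + 3 * γ ^ 2 * L ^ 2) * ‖x - xstar‖ ^ 2 +
        (2 * γ ^ 2 / (n : ℝ)) * ∑ i : Fin n, ‖φ i - Bi i xstar‖ ^ 2 := by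
  have hn0 : (0 : ℝ) < n := by exact_mod_cast hn
  set m : E := (1 / (n : ℝ)) • ∑ j : Fin n, (φ j - Bi j xstar) with hm
  have hmsum : ∑ j : Fin n, (φ j - Bi j xstar) = (n : ℝ) • m := by
    rw [hm, smul_smul, mul_one_div_cancel hn0.ne', one_smul]
  have husum : ∑ j : Fin n, (Bi j x - Bi j xstar) = (n : ℝ) • (B x - B xstar) := by
    rw [hB, hB, ← smul_sub, smul_smul, mul_one_div_cancel hn0.ne', one_smul,
      Finset.sum_sub_distrib]
  have key : ∀ i : Fin n,
      ‖J (x - γ • (Bi i x - φ i + (1 / (n : ℝ)) • ∑ j : Fin n, φ j)) - xstar‖ ^ 2 ≤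
        (1 + 2 * γ ^ 2 * L ^ 2) * ‖x - xstar‖ ^ 2
          - 2 * γ * ⟪Bi i x - Bi i xstar, x - xstar⟫
          + 2 * γ * ⟪φ i - Bi i xstar, x - xstar⟫ - 2 * γ * ⟪m, x - xstar⟫
          + 2 * γ ^ 2 * (‖φ i - Bi i xstar‖ ^ 2 - 2 * ⟪φ i - Bi i xstar, m⟫ + ‖m‖ ^ 2) := by
    intro i
    have h1 := hJ (x - γ • (Bi i x - φ i + (1 / (n : ℝ)) • ∑ j : Fin n, φ j))
      (xstar - γ • B xstar)
    rw [hfix] at h1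
    have e : x - γ • (Bi i x - φ i + (1 / (n : ℝ)) • ∑ j : Fin n, φ j) - (xstar - γ • B xstar)
        = (x - xstar) - γ • ((Bi i x - Bi i xstar) - ((φ i - Bi i xstar) - m)) := by
      rw [hm, hB, Finset.sum_sub_distrib]
      module
    rw [e] at h1
    have h2 := pow_le_pow_left₀ (norm_nonneg _) h1 2
    refine h2.trans ?_
    have h3 := pow_le_pow_left₀ (norm_nonneg _) (hlip i x xstar) 2
    generalize Bi i x - Bi i xstar = u at *
    generalize φ i - Bi i xstar = w at *
    generalize x - xstar = d at *
    have h4 : ‖u - (w - m)‖ ^ 2 ≤ 2 * ‖u‖ ^ 2 + 2 * ‖w - m‖ ^ 2 := by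
      have := parallelogram_law_with_norm ℝ u (w - m)
      nlinarith [sq_nonneg ‖u + (w - m)‖]
    have h5 := norm_sub_sq_real w m
    have h6 : ‖d - γ • (u - (w - m))‖ ^ 2 = ‖d‖ ^ 2
        - 2 * γ * (⟪u, d⟫ - (⟪w, d⟫ - ⟪m, d⟫)) + γ ^ 2 * ‖u - (w - m)‖ ^ 2 := by
      rw [norm_sub_sq_real, norm_smul, mul_pow, Real.norm_eq_abs, sq_abs, real_inner_smul_right,
        real_inner_comm, inner_sub_left, inner_sub_left]
      ring
    rw [h6]
    have h7 : ‖u - (w - m)‖ ^ 2 ≤ 2 * (L * ‖d‖) ^ 2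
        + 2 * (‖w‖ ^ 2 - 2 * ⟪w, m⟫ + ‖m‖ ^ 2) := by linarith
    have h8 := mul_le_mul_of_nonneg_left h7 (sq_nonneg γ)
    linarith
  have hs := Finset.sum_le_sum (fun i (_ : i ∈ Finset.univ) => key i)
  simp only [Finset.sum_add_distrib, Finset.sum_sub_distrib, ← Finset.mul_sum, ← sum_inner,
    Finset.sum_const, Finset.card_univ, Fintype.card_fin, nsmul_eq_mul] at hs
  simp only [← Finset.sum_sub_distrib, hmsum, husum, ← Nat.cast_smul_eq_nsmul ℝ n m,
    real_inner_smul_left,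
    real_inner_self_eq_norm_sq] at hs
  have hmo := hmono x xstar
  have hd := mul_le_mul_of_nonneg_left hs (one_div_pos.mpr hn0).le
  refine hd.trans ?_
  have e2 : (2 * γ ^ 2 / (n : ℝ)) * ∑ i : Fin n, ‖φ i - Bi i xstar‖ ^ 2
      = (1 / (n : ℝ)) * (2 * γ ^ 2 * ∑ i : Fin n, ‖φ i - Bi i xstar‖ ^ 2) := by ring
  rw [e2]
  generalize ∑ i : Fin n, ‖φ i - Bi i xstar‖ ^ 2 = S at *
  have e3 : ∀ a : ℝ, a = (1 / (n : ℝ)) * (n * a) := by intro a; field_simp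
  rw [e3 ((1 - 2 * γ * μ + 3 * γ ^ 2 * L ^ 2) * ‖x - xstar‖ ^ 2), ← mul_add]
  refine mul_le_mul_of_nonneg_left ?_ (one_div_pos.mpr hn0).le
  have p1 := mul_le_mul_of_nonneg_left hmo (mul_pos hn0 hγ).le
  have p2 : 0 ≤ n * (γ ^ 2 * ‖m‖ ^ 2) := by positivity
  have p3 : 0 ≤ n * (γ ^ 2 * L ^ 2 * ‖x - xstar‖ ^ 2) := by positivity
  linarith
end

section
/- Let μ > 0, L > 0, c₁ ∈ [0, 1), c₂ ≥ 0, c₃ ≥ 0, and m̄ ≥ 1 be real numbers. Suppose γ > 0 satisfies γ < min{ (2μ / ((3(1 − c₁)L²)/2 + (1 − c₁)c₃m̄ + c₂))², ((1 − c₁) / (2 + 2m̄((1 − c₁)/2)³c₃))² }. Set ρ = γ^{3/2}, θ = max{1 − 2γμ + 3γ²L² + c₂ρ, 2γ²/ρ + c₁}, and λ = θ + 2γ²m̄c₃. Then 0 ≤ θ < 1 and 0 ≤ λ < 1. -/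
/-- Under the paper's step-size rule, the contraction factors θ and λ of the
Lyapunov analysis lie in [0, 1). -/
theorem contraction_factors_lt_one
    (μ L c₁ c₂ c₃ mbar γ ρ θ lam : ℝ)
    (hμ : 0 < μ) (hL : 0 < L) (hc₁0 : 0 ≤ c₁) (hc₁1 : c₁ < 1)
    (hc₂ : 0 ≤ c₂) (hc₃ : 0 ≤ c₃) (hm : 1 ≤ mbar) (hγ : 0 < γ)
    (hstep : γ <
      min ((2 * μ / (3 * (1 - c₁) * L ^ 2 / 2 + (1 - c₁) * c₃ * mbar + c₂)) ^ 2)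
        (((1 - c₁) / (2 + 2 * mbar * ((1 - c₁) / 2) ^ 3 * c₃)) ^ 2))
    (hρ : ρ = γ ^ ((3 : ℝ) / 2))
    (hθ : θ = max (1 - 2 * γ * μ + 3 * γ ^ 2 * L ^ 2 + c₂ * ρ) (2 * γ ^ 2 / ρ + c₁))
    (hlam : lam = θ + 2 * γ ^ 2 * mbar * c₃) :
    0 ≤ θ ∧ θ < 1 ∧ 0 ≤ lam ∧ lam < 1 := by
  obtain ⟨h1, h2⟩ := lt_min_iff.mp hstep
  obtain ⟨s, hs, rfl⟩ : ∃ s : ℝ, 0 < s ∧ γ = s ^ 2 :=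
    ⟨√γ, Real.sqrt_pos.mpr hγ, (Real.sq_sqrt hγ.le).symm⟩
  have hρ' : ρ = s ^ 3 := by
    rw [hρ, ← Real.rpow_natCast s 2, ← Real.rpow_mul hs.le, ← Real.rpow_natCast s 3]
    norm_num
  obtain ⟨a, rfl⟩ : ∃ a, c₁ = 1 - a := ⟨1 - c₁, by ring⟩
  simp only [sub_sub_cancel] at h1 h2
  have ha : 0 < a := by linarith
  have hm0 : 0 < mbar := by linarith
  have hD : 0 < 3 * a * L ^ 2 / 2 + a * c₃ * mbar + c₂ := by positivity
  have hE : 0 < 2 + 2 * mbar * (a / 2) ^ 3 * c₃ := by positivity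
  have k1 := (lt_div_iff₀ hD).mp (lt_of_pow_lt_pow_left₀ 2 (by positivity) h1)
  have k2 := (lt_div_iff₀ hE).mp (lt_of_pow_lt_pow_left₀ 2 (by positivity) h2)
  have hsa : s ≤ a / 2 := by
    have : 0 ≤ s * (2 * mbar * (a / 2) ^ 3 * c₃) := by positivity
    linarith
  have hq : 2 * (s ^ 2) ^ 2 / ρ = 2 * s := by
    rw [hρ']; field_simp
  rw [hq] at hθ
  have hext : 0 ≤ 2 * (s ^ 2) ^ 2 * mbar * c₃ := by positivity
  have hθ0 : 0 ≤ θ := by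
    rw [hθ]
    exact le_max_of_le_right (by linarith)
  have hl : lam < 1 := by
    have hA : 1 - 2 * s ^ 2 * μ + 3 * (s ^ 2) ^ 2 * L ^ 2 + c₂ * ρ
        < 1 - 2 * (s ^ 2) ^ 2 * mbar * c₃ := by
      have e1 : s * (3 * s * L ^ 2 + 2 * s * c₃ * mbar + c₂) < 2 * μ := by
        refine lt_of_le_of_lt (mul_le_mul_of_nonneg_left ?_ hs.le) k1
        have : s * (3 * L ^ 2 + 2 * (c₃ * mbar)) ≤ a / 2 * (3 * L ^ 2 + 2 * (c₃ * mbar)) :=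
          mul_le_mul_of_nonneg_right hsa (by positivity)
        linarith
      have e2 := mul_lt_mul_of_pos_left e1 (pow_pos hs 2)
      rw [hρ']
      linarith
    have hB : 2 * s + (1 - a) < 1 - 2 * (s ^ 2) ^ 2 * mbar * c₃ := by
      have e1 : s ^ 3 ≤ (a / 2) ^ 3 := pow_le_pow_left₀ hs.le hsa 3
      have e2 : s ^ 3 * (2 * s * mbar * c₃) ≤ (a / 2) ^ 3 * (2 * s * mbar * c₃) :=
        mul_le_mul_of_nonneg_right e1 (by positivity)
      linarith
    have := max_lt hA hB
    rw [← hθ] at this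
    linarith
  exact ⟨hθ0, by linarith, by linarith, hl⟩
end

section
/- Let μ > 0, L > 0, c₁ ∈ [0, 1), c₂ ≥ 0, c₃ ≥ 0, and m̄ ≥ 1, and suppose γ > 0 satisfies γ < min{ (2μ / ((3(1 − c₁)L²)/2 + (1 − c₁)c₃m̄ + c₂))², ((1 − c₁) / (2 + 2m̄((1 − c₁)/2)³c₃))² }. Set ρ = γ^{3/2}, θ = max{1 − 2γμ + 3γ²L² + c₂ρ, 2γ²/ρ + c₁}, and λ = θ + 2γ²m̄c₃. Let S : ℕ → ℕ be strictly increasing with S(0) = 0 and S(i+1) − S(i) ≤ m̄ for all i. Let a, g, h : ℕ → ℝ be nonnegative sequences such that for all k ≥ 0: a(k+1) ≤ (1 − 2γμ + 3γ²L²)a(k) + 2γ²(g(k) + h(k)) and g(k+1) ≤ c₁g(k) + c₂a(k), and such that for every i ≥ 0 and every k with S(i) ≤ k < S(i+1): h(k) ≤ c₃(a(S(i)) + ρg(S(i))). Then for all k ≥ 1, a(S(k)) + ρg(S(k)) ≤ λ(a(S(k−1)) + ρg(S(k−1))); moreover, if in addition g(0) ≤ L²a(0), then a(S(k)) ≤ λ^k(1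 + ρL²)a(0) for all k ≥ 1. -/
/-- Deterministic-sequence form of the main linear convergence theorem for
variance-reduced forward-backward splitting. -/
theorem lyapunov_linear_convergence
    (μ L c₁ c₂ c₃ mbar γ ρ θ lam : ℝ)
    (hμ : 0 < μ) (hL : 0 < L) (hc₁0 : 0 ≤ c₁) (hc₁1 : c₁ < 1)
    (hc₂ : 0 ≤ c₂) (hc₃ : 0 ≤ c₃) (hm : 1 ≤ mbar) (hγ : 0 < γ)
    (hstep : γ <
      min ((2 * μ / (3 * (1 - c₁) * L ^ 2 / 2 + (1 - c₁) * c₃ * mbar + c₂)) ^ 2)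
        (((1 - c₁) / (2 + 2 * mbar * ((1 - c₁) / 2) ^ 3 * c₃)) ^ 2))
    (hρ : ρ = γ ^ ((3 : ℝ) / 2))
    (hθ : θ = max (1 - 2 * γ * μ + 3 * γ ^ 2 * L ^ 2 + c₂ * ρ) (2 * γ ^ 2 / ρ + c₁))
    (hlam : lam = θ + 2 * γ ^ 2 * mbar * c₃)
    (S : ℕ → ℕ) (hS0 : S 0 = 0) (hSmono : StrictMono S)
    (hSlen : ∀ i : ℕ, (S (i + 1) : ℝ) - (S i : ℝ) ≤ mbar)
    (a g h : ℕ → ℝ)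
    (ha0 : ∀ k, 0 ≤ a k) (hg0 : ∀ k, 0 ≤ g k) (hh0 : ∀ k, 0 ≤ h k)
    (harec : ∀ k : ℕ,
      a (k + 1) ≤ (1 - 2 * γ * μ + 3 * γ ^ 2 * L ^ 2) * a k + 2 * γ ^ 2 * (g k + h k))
    (hgrec : ∀ k : ℕ, g (k + 1) ≤ c₁ * g k + c₂ * a k)
    (hhbound : ∀ i k : ℕ, S i ≤ k → k < S (i + 1) →
      h k ≤ c₃ * (a (S i) + ρ * g (S i))) :
    (∀ k : ℕ, 1 ≤ k →
      a (S k) + ρ * g (S k) ≤ lam * (a (S (k - 1)) + ρ * g (S (k - 1)))) ∧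
    (g 0 ≤ L ^ 2 * a 0 → ∀ k : ℕ, 1 ≤ k →
      a (S k) ≤ lam ^ k * (1 + ρ * L ^ 2) * a 0) := by
  obtain ⟨s, hs, rfl⟩ : ∃ s : ℝ, 0 < s ∧ γ = s ^ 2 :=
    ⟨Real.sqrt γ, Real.sqrt_pos.mpr hγ, (Real.sq_sqrt hγ.le).symm⟩
  have hρ' : ρ = s ^ 3 := by
    rw [hρ, ← Real.rpow_natCast s 2, ← Real.rpow_mul hs.le, ← Real.rpow_natCast s 3]
    norm_num
  clear hρ
  subst hρ'
  have hc : 0 < 1 - c₁ := by linarith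
  have hm0 : 0 < mbar := by linarith
  obtain ⟨h1, h2⟩ := lt_min_iff.mp hstep
  have hD : 0 < 3 * (1 - c₁) * L ^ 2 / 2 + (1 - c₁) * c₃ * mbar + c₂ := by positivity
  have hE0 : 0 ≤ 2 * mbar * ((1 - c₁) / 2) ^ 3 * c₃ := by positivity
  have hE : 0 < 2 + 2 * mbar * ((1 - c₁) / 2) ^ 3 * c₃ := by linarith
  have h1' := lt_of_pow_lt_pow_left₀ 2 (by positivity) h1
  have h2' := lt_of_pow_lt_pow_left₀ 2 (by positivity) h2
  rw [lt_div_iff₀ hD] at h1'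
  rw [lt_div_iff₀ hE] at h2'
  have hs2 : 2 * s ≤ 1 - c₁ := by nlinarith [mul_nonneg hs.le hE0]
  have hdiv : 2 * (s ^ 2) ^ 2 / s ^ 3 = 2 * s := by field_simp
  rw [hdiv] at hθ
  have hθA : 1 - 2 * s ^ 2 * μ + 3 * (s ^ 2) ^ 2 * L ^ 2 + c₂ * s ^ 3 ≤ θ := hθ ▸ le_max_left _ _
  have hθB : 2 * s + c₁ ≤ θ := hθ ▸ le_max_right _ _
  have hθ0 : 0 ≤ θ := by linarith
  have hθ1 : θ ≤ 1 := by
    rw [hθ]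
    apply max_le _ (by linarith)
    have e1 : 0 ≤ s * ((1 - c₁) * c₃ * mbar) := by positivity
    have e2 : 0 ≤ (s * L ^ 2) * (1 - c₁ - 2 * s) := mul_nonneg (by positivity) (by linarith)
    have e3 : 0 ≤ 2 * μ - 3 * s ^ 2 * L ^ 2 - c₂ * s := by nlinarith
    have e4 := mul_nonneg (sq_nonneg s) e3
    nlinarith
  have hd0 : 0 ≤ 2 * (s ^ 2) ^ 2 * c₃ := by positivity
  have hlam0 : 0 ≤ lam := by rw [hlam]; positivity
  set d := 2 * (s ^ 2) ^ 2 * c₃ with hd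
  have hV0 : ∀ k, 0 ≤ a k + s ^ 3 * g k := fun k =>
    add_nonneg (ha0 k) (mul_nonneg (by positivity) (hg0 k))
  have hstepV : ∀ i k : ℕ, S i ≤ k → k < S (i + 1) →
      a (k + 1) + s ^ 3 * g (k + 1) ≤
        θ * (a k + s ^ 3 * g k) + d * (a (S i) + s ^ 3 * g (S i)) := by
    intro i k hk hk'
    have f1 := harec k
    have f2 := mul_le_mul_of_nonneg_left (hgrec k) (by positivity : 0 ≤ s ^ 3)
    have f3 := mul_le_mul_of_nonneg_left (hhbound i k hk hk') (by positivity : 0 ≤ 2 * (s ^ 2) ^ 2)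
    have f4 := mul_le_mul_of_nonneg_right hθA (ha0 k)
    have f5 := mul_le_mul_of_nonneg_right hθB (mul_nonneg (by positivity : 0 ≤ s ^ 3) (hg0 k))
    rw [hd]
    linarith
  have hind : ∀ i n : ℕ, S i + n + 1 ≤ S (i + 1) →
      a (S i + n + 1) + s ^ 3 * g (S i + n + 1) ≤
        (θ + (n + 1 : ℕ) * d) * (a (S i) + s ^ 3 * g (S i)) := by
    intro i n
    induction n with
    | zero =>
      intro hn
      have := hstepV i (S i) le_rfl (by omega)
      simp only [add_zero, zero_add, Nat.cast_one]
      linarith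
    | succ n ih =>
      intro hn
      have f1 := hstepV i (S i + n + 1) (by omega) (by omega)
      have f2 := mul_le_mul_of_nonneg_left (ih (by omega)) hθ0
      have f3 : θ * (θ + (n + 1 : ℕ) * d) ≤ 1 * (θ + (n + 1 : ℕ) * d) :=
        mul_le_mul_of_nonneg_right hθ1 (by positivity)
      have f4 := mul_le_mul_of_nonneg_right f3 (hV0 (S i))
      have e : S i + (n + 1) + 1 = S i + n + 1 + 1 := by omega
      rw [e]
      push_cast at *
      linarith
  have hmain : ∀ i : ℕ, a (S (i + 1)) + s ^ 3 * g (S (i + 1)) ≤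
      lam * (a (S i) + s ^ 3 * g (S i)) := by
    intro i
    have hlt : S i < S (i + 1) := hSmono (Nat.lt_succ_self i)
    obtain ⟨n, hn⟩ := Nat.exists_eq_add_of_lt hlt
    have f := hind i n hn.symm.le
    rw [← hn] at f
    refine f.trans (mul_le_mul_of_nonneg_right ?_ (hV0 _))
    have hl := hSlen i
    rw [hn] at hl
    push_cast at hl
    have : ((n + 1 : ℕ) : ℝ) ≤ mbar := by push_cast; linarith
    have := mul_le_mul_of_nonneg_right this hd0
    rw [hlam]
    rw [hd] at this ⊢
    linarith
  refine ⟨?_, ?_⟩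
  · intro k hk
    obtain ⟨i, rfl⟩ := Nat.exists_eq_add_of_le' hk
    exact hmain i
  · intro hg k _
    have hpow : ∀ k, a (S k) + s ^ 3 * g (S k) ≤ lam ^ k * (a 0 + s ^ 3 * g 0) := by
      intro k
      induction k with
      | zero => simp [hS0]
      | succ k ih =>
        have := mul_le_mul_of_nonneg_left ih hlam0
        have := hmain k
        rw [pow_succ' lam k]
        linarith
    have q1 := hpow k
    have q2 : 0 ≤ s ^ 3 * g (S k) := mul_nonneg (by positivity) (hg0 _)
    have q3 := mul_le_mul_of_nonneg_left hg (by positivity : 0 ≤ s ^ 3)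
    have q4 := mul_le_mul_of_nonneg_left q3 (pow_nonneg hlam0 k)
    linarith
end

section
/- Let E be a real inner product space, let μ > 0 and σ > 0, and let F : E → E be μ-strongly monotone, i.e., ⟨F x − F y, x − y⟩ ≥ μ‖x − y‖² for all x, y ∈ E. Suppose P : E → E satisfies F(P(z)) + σ • (P(z) − z) = 0 for all z ∈ E, and let x* ∈ E satisfy F(x*) = 0. If x, y ∈ E satisfy ‖y − P(x)‖ ≤ (1/(2(1 + σ/μ)))‖x − P(x)‖, then ‖y − x*‖ ≤ (1 − 1/(2(1 + σ/μ)))‖x − x*‖. -/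
open scoped RealInnerProductSpace

/-- Catalyst outer-loop contraction (single-valued form): if the inner solver
returns `y` within relative accuracy 1/(2(1+σ/μ)) of the auxiliary solution
P(x), then the distance to the zero of F contracts. -/
theorem catalyst_outer_contraction
    {E : Type*} [NormedAddCommGroup E] [InnerProductSpace ℝ E]
    (μ σ : ℝ) (hμ : 0 < μ) (hσ : 0 < σ) (F : E → E)
    (hmono : ∀ x y : E, μ * ‖x - y‖ ^ 2 ≤ ⟪F x - F y, x - y⟫)
    (P : E → E) (hP : ∀ z : E, F (P z) + σ • (P z - z) = 0)
    (xstar : E) (hxstar : F xstar = 0)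
    (x y : E)
    (hy : ‖y - P x‖ ≤ (1 / (2 * (1 + σ / μ))) * ‖x - P x‖) :
    ‖y - xstar‖ ≤ (1 - 1 / (2 * (1 + σ / μ))) * ‖x - xstar‖ := by
  obtain ⟨q, hq⟩ : ∃ q : ℝ, q = μ / (μ + σ) := ⟨_, rfl⟩
  have hms : 0 < μ + σ := by positivity
  have hq0 : 0 < q := by rw [hq]; positivity
  have hqm : q * (μ + σ) = μ := by rw [hq]; field_simp
  have hq1 : q < 1 := by rw [hq, div_lt_one hms]; linarith
  have hcoef : 1 / (2 * (1 + σ / μ)) = q / 2 := by rw [hq]; field_simp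
  rw [hcoef] at hy ⊢
  have hF : F (P x) = σ • (x - P x) := by
    rw [eq_neg_of_add_eq_zero_left (hP x), ← smul_neg, neg_sub]
  have h1 := hmono (P x) xstar
  rw [hxstar, sub_zero, hF, real_inner_smul_left] at h1
  have h2 : ‖x - xstar‖ ^ 2 =
      ‖x - P x‖ ^ 2 + 2 * ⟪x - P x, P x - xstar⟫ + ‖P x - xstar‖ ^ 2 := by
    rw [← norm_add_sq_real, sub_add_sub_cancel]
  have h3 : ‖y - xstar‖ ≤ ‖y - P x‖ + ‖P x - xstar‖ := norm_sub_le_norm_sub_add_norm_sub _ _ _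
  have hA := norm_nonneg (x - xstar)
  have hr := norm_nonneg (P x - xstar)
  have hs := norm_nonneg (x - P x)
  generalize ‖x - xstar‖ = A at *
  generalize ‖P x - xstar‖ = r at *
  generalize ‖x - P x‖ = s at *
  generalize ⟪x - P x, P x - xstar⟫ = t at *
  have hc : 0 < 1 - q := by linarith
  have h4 : q * r ^ 2 ≤ (1 - q) * t := by
    have e1 : q * r ^ 2 * (μ + σ) = μ * r ^ 2 := by linear_combination r ^ 2 * hqm
    have e2 : (1 - q) * t * (μ + σ) = σ * t := by linear_combination -t * hqm
    exact le_of_mul_le_mul_right (by rw [e1, e2]; exact h1) hms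
  have h5 : (1 - q) * s ^ 2 + r ^ 2 ≤ (1 - q) * A ^ 2 := by
    rw [h2]; nlinarith [mul_nonneg hq0.le (sq_nonneg r)]
  have h6 : (r + q / 2 * s) ^ 2 ≤ ((1 - q / 2) * A) ^ 2 := by
    refine le_of_mul_le_mul_left ?_ hc
    have h7 := mul_le_mul_of_nonneg_left h5 (sq_nonneg (1 - q / 2))
    nlinarith [sq_nonneg ((1 - q) * s - q * r / 2)]
  have h8 := abs_le_of_sq_le_sq h6 (mul_nonneg (by linarith) hA)
  linarith [le_abs_self (r + q / 2 * s)]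
end

section
/- Let E be a real inner product space, let μ > 0, γ > 0, let B : E → E be μ-strongly monotone, and let x* ∈ E satisfy B(x*) = 0. Let n ≥ 1, let x, x̂ ∈ E, and let g : {1,…,n} → E satisfy (1/n)∑_{i=1}^n g(i) = B(x̂). Then (1/n)∑_{i=1}^n ‖(x − γ • g(i)) − x*‖² ≤ (1 − γμ)‖x − x*‖² + 2γμ‖x̂ − x‖² + γ² · (1/n)∑_{i=1}^n ‖g(i)‖² + 2γ · (1/n)∑_{i=1}^n ⟨g(i), x̂ − x⟩. -/
open scoped RealInnerProductSpace

/-- One-step expected error bound for the asynchronous perturbed forward-step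
iterate, with the conditional expectation written as a uniform average. -/
theorem asynchronous_one_step_error
    {E : Type*} [NormedAddCommGroup E] [InnerProductSpace ℝ E]
    (μ γ : ℝ) (hμ : 0 < μ) (hγ : 0 < γ)
    (B : E → E)
    (hmono : ∀ x y : E, μ * ‖x - y‖ ^ 2 ≤ ⟪B x - B y, x - y⟫)
    (xstar : E) (hxstar : B xstar = 0)
    (n : ℕ) (hn : 1 ≤ n) (x xhat : E) (g : Fin n → E)
    (hunbiased : (1 / (n : ℝ)) • ∑ i : Fin n, g i = B xhat) :
    (1 / (n : ℝ)) * ∑ i : Fin n, ‖(x - γ • g i) - xstar‖ ^ 2 ≤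
      (1 - γ * μ) * ‖x - xstar‖ ^ 2 + 2 * γ * μ * ‖xhat - x‖ ^ 2 +
        γ ^ 2 * ((1 / (n : ℝ)) * ∑ i : Fin n, ‖g i‖ ^ 2) +
        2 * γ * ((1 / (n : ℝ)) * ∑ i : Fin n, ⟪g i, xhat - x⟫) := by
  have hn0 : (n : ℝ) ≠ 0 := by
    have : 0 < n := hn
    positivity
  have hav : ∀ v : E, (1 / (n : ℝ)) * ∑ i : Fin n, ⟪g i, v⟫ = ⟪B xhat, v⟫ := by
    intro v
    rw [← hunbiased, real_inner_smul_left, sum_inner]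
  have hterm : ∀ i : Fin n, ‖(x - γ • g i) - xstar‖ ^ 2 =
      ‖x - xstar‖ ^ 2 - 2 * γ * ⟪g i, x - xstar⟫ + γ ^ 2 * ‖g i‖ ^ 2 := by
    intro i
    have h : (x - γ • g i) - xstar = (x - xstar) - γ • g i := by abel
    rw [h, norm_sub_sq_real, real_inner_smul_right, norm_smul, mul_pow, Real.norm_eq_abs,
      sq_abs, real_inner_comm]
    ring
  have hL : (1 / (n : ℝ)) * ∑ i : Fin n, ‖(x - γ • g i) - xstar‖ ^ 2 =
      ‖x - xstar‖ ^ 2 - 2 * γ * ⟪B xhat, x - xstar⟫ +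
        γ ^ 2 * ((1 / (n : ℝ)) * ∑ i : Fin n, ‖g i‖ ^ 2) := by
    rw [← hav]
    simp only [hterm, Finset.sum_add_distrib, Finset.sum_sub_distrib, ← Finset.mul_sum,
      Finset.sum_const, Finset.card_univ, Fintype.card_fin, nsmul_eq_mul]
    field_simp
  rw [hL, hav]
  have hm := hmono xhat xstar
  rw [hxstar, sub_zero] at hm
  have hsplit : ⟪B xhat, xhat - xstar⟫ = ⟪B xhat, xhat - x⟫ + ⟪B xhat, x - xstar⟫ := by
    rw [← inner_add_right, sub_add_sub_cancel]
  have htri : ‖x - xstar‖ ^ 2 ≤ 2 * ‖xhat - x‖ ^ 2 + 2 * ‖xhat - xstar‖ ^ 2 := by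
    have h := norm_sub_le (xhat - xstar) (xhat - x)
    rw [sub_sub_sub_cancel_left] at h
    nlinarith [norm_nonneg (x - xstar), sq_nonneg (‖xhat - xstar‖ - ‖xhat - x‖)]
  have h1 := mul_le_mul_of_nonneg_left htri (mul_pos hγ hμ).le
  have h2 := mul_le_mul_of_nonneg_left hm hγ.le
  rw [hsplit] at h2
  linarith
end

section
/- Let E be a real inner product space, let n ≥ 1 and L > 0, let B₁, …, Bₙ : E → E each be L-Lipschitz, let B = (1/n)∑_{i=1}^n Bᵢ, and let x* ∈ E satisfy B(x*) = 0. Let x, x̂ ∈ E and φ₁, …, φₙ, φ̂₁, …, φ̂ₙ ∈ E, and for each i define Ĝ(i) = Bᵢ(x̂) − φ̂ᵢ + (1/n)∑_{j=1}^n φ̂ⱼ. Then (1/n)∑_{i=1}^n ‖Ĝ(i)‖² ≤ 6L²‖x̂ − x‖² + 6L²‖x − x*‖² + (4/n)∑_{i=1}^n ‖φᵢ − Bᵢ(x*)‖² + (4/n)∑_{i=1}^n ‖φᵢ − φ̂ᵢ‖². -/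
open scoped RealInnerProductSpace

/-- Second-moment bound for the asynchronous variance-reduced estimator
Ĝ(i) = Bᵢ(x̂) − φ̂ᵢ + (1/n)∑ⱼ φ̂ⱼ over a uniformly sampled index. -/
theorem asynchronous_estimator_second_moment
    {E : Type*} [NormedAddCommGroup E] [InnerProductSpace ℝ E]
    (n : ℕ) (hn : 1 ≤ n) (L : ℝ) (hL : 0 < L)
    (Bi : Fin n → E → E)
    (hlip : ∀ i : Fin n, ∀ x y : E, ‖Bi i x - Bi i y‖ ≤ L * ‖x - y‖)
    (B : E → E) (hB : ∀ x : E, B x = (1 / (n : ℝ)) • ∑ i : Fin n, Bi i x)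
    (xstar : E) (hxstar : B xstar = 0)
    (x xhat : E) (φ φhat : Fin n → E) :
    (1 / (n : ℝ)) *
        ∑ i : Fin n, ‖Bi i xhat - φhat i + (1 / (n : ℝ)) • ∑ j : Fin n, φhat j‖ ^ 2 ≤
      6 * L ^ 2 * ‖xhat - x‖ ^ 2 + 6 * L ^ 2 * ‖x - xstar‖ ^ 2 +
        (4 / (n : ℝ)) * ∑ i : Fin n, ‖φ i - Bi i xstar‖ ^ 2 +
        (4 / (n : ℝ)) * ∑ i : Fin n, ‖φ i - φhat i‖ ^ 2 := by
  have hn0 : (0 : ℝ) < n := by exact_mod_cast hn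
  have par : ∀ u v : E, ‖u + v‖ ^ 2 ≤ 2 * ‖u‖ ^ 2 + 2 * ‖v‖ ^ 2 := by
    intro u v
    have h := norm_add_le u v
    nlinarith [norm_nonneg (u + v), norm_nonneg u, norm_nonneg v, sq_nonneg (‖u‖ - ‖v‖)]
  have hs : ∑ i : Fin n, Bi i xstar = 0 := by
    have h := hB xstar
    rw [hxstar] at h
    have h2 := smul_eq_zero.mp h.symm
    rcases h2 with h2 | h2
    · exact absurd h2 (by positivity)
    · exact h2
  set m : E := (1 / (n : ℝ)) • ∑ j : Fin n, φhat j with hm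
  have hsum : ∑ i : Fin n, (φhat i - Bi i xstar) = (n : ℝ) • m := by
    rw [Finset.sum_sub_distrib, hs, sub_zero, hm, smul_smul, mul_one_div_cancel hn0.ne', one_smul]
  have hinner : ∑ i : Fin n, (inner ℝ (φhat i - Bi i xstar) m : ℝ) = n * ‖m‖ ^ 2 := by
    rw [← sum_inner, hsum, real_inner_smul_left, real_inner_self_eq_norm_sq]
  have hpt : ∀ i : Fin n, ‖Bi i xhat - φhat i + m‖ ^ 2 ≤
      (4 * L ^ 2 * ‖xhat - x‖ ^ 2 + 4 * L ^ 2 * ‖x - xstar‖ ^ 2 + 2 * ‖m‖ ^ 2)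
        + 4 * ‖φ i - Bi i xstar‖ ^ 2 + 4 * ‖φ i - φhat i‖ ^ 2
        - 4 * (inner ℝ (φhat i - Bi i xstar) m : ℝ) := by
    intro i
    have h1 := par (Bi i xhat - Bi i xstar) (-((φhat i - Bi i xstar) - m))
    rw [show Bi i xhat - Bi i xstar + -((φhat i - Bi i xstar) - m)
      = Bi i xhat - φhat i + m by abel, norm_neg, norm_sub_sq_real (φhat i - Bi i xstar) m] at h1
    have h2 := par (φ i - Bi i xstar) (-(φ i - φhat i))
    rw [show φ i - Bi i xstar + -(φ i - φhat i) = φhat i - Bi i xstar by abel, norm_neg] at h2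
    have h3 := par (xhat - x) (x - xstar)
    rw [sub_add_sub_cancel] at h3
    have h4 : ‖Bi i xhat - Bi i xstar‖ ^ 2 ≤ L ^ 2 * ‖xhat - xstar‖ ^ 2 := by
      rw [← mul_pow]
      exact pow_le_pow_left₀ (norm_nonneg _) (hlip i _ _) 2
    have h5 := mul_le_mul_of_nonneg_left h3 (sq_nonneg L)
    linarith
  have htot := Finset.sum_le_sum (fun i (_ : i ∈ Finset.univ) => hpt i)
  rw [Finset.sum_sub_distrib, Finset.sum_add_distrib, Finset.sum_add_distrib,
    ← Finset.mul_sum, ← Finset.mul_sum, ← Finset.mul_sum, hinner, Finset.sum_const,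
    Finset.card_univ, Fintype.card_fin, nsmul_eq_mul] at htot
  have h6 := mul_le_mul_of_nonneg_left htot (show (0 : ℝ) ≤ 1 / n by positivity)
  refine h6.trans ?_
  have e : ∀ c p q : ℝ, 1 / (n : ℝ) * (n * (c + 2 * ‖m‖ ^ 2) + 4 * p + 4 * q
      - 4 * (n * ‖m‖ ^ 2)) = c - 2 * ‖m‖ ^ 2 + 4 / n * p + 4 / n * q := by
    intro c p q
    field_simp
    ring
  rw [e]
  have p1 : 0 ≤ L ^ 2 * ‖xhat - x‖ ^ 2 := by positivity
  have p2 : 0 ≤ L ^ 2 * ‖x - xstar‖ ^ 2 := by positivity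
  have p3 : 0 ≤ ‖m‖ ^ 2 := by positivity
  linarith
end

section
/- Let E be a real inner product space, let n ≥ 1, μ > 0, L > 0, γ > 0, τ ≥ 0, M ≥ 0. Let B₁, …, Bₙ : E → E each be L-Lipschitz, let B = (1/n)∑_{i=1}^n Bᵢ be μ-strongly monotone, and let x* ∈ E satisfy B(x*) = 0. Let x, x̂ ∈ E and φ₁, …, φₙ, φ̂₁, …, φ̂ₙ ∈ E, define Ĝ(i) = Bᵢ(x̂) − φ̂ᵢ + (1/n)∑_{j=1}^n φ̂ⱼ for each i, and assume ‖x̂ − x‖ ≤ γτM and ‖Ĝ(i)‖ ≤ M for all i. Then (1/n)∑_{i=1}^n ‖(x − γ • Ĝ(i)) − x*‖² ≤ (1 − γμ + 6γ²L²)‖x − x*‖² + (4γ²/n)∑_{i=1}^n ‖φᵢ − Bᵢ(x*)‖² + (4γ²/n)∑_{i=1}^n ‖φᵢ − φ̂ᵢ‖² + 2γ³μτ²M² + 6γ⁴L²τ²M² + 2γ²τM². -/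
open scoped RealInnerProductSpace

theorem aux_sq_add {E : Type*} [NormedAddCommGroup E] [InnerProductSpace ℝ E] (a b : E) :
    ‖a + b‖ ^ 2 ≤ 2 * ‖a‖ ^ 2 + 2 * ‖b‖ ^ 2 := by
  have h1 := norm_add_sq_real a b
  have h2 := norm_sub_sq_real a b
  nlinarith [sq_nonneg ‖a - b‖]

theorem aux_sq_sub {E : Type*} [NormedAddCommGroup E] [InnerProductSpace ℝ E] (a b : E) :
    ‖a - b‖ ^ 2 ≤ 2 * ‖a‖ ^ 2 + 2 * ‖b‖ ^ 2 := by
  have h1 := norm_add_sq_real a b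
  have h2 := norm_sub_sq_real a b
  nlinarith [sq_nonneg ‖a + b‖]

theorem aux_var {E : Type*} [NormedAddCommGroup E] [InnerProductSpace ℝ E] (n : ℕ)
    (a : Fin n → E) (m : E) (hm : ∑ i, a i = (n : ℝ) • m) :
    ∑ i, ‖a i - m‖ ^ 2 ≤ ∑ i, ‖a i‖ ^ 2 := by
  have h : ∑ i, ‖a i - m‖ ^ 2 = ∑ i, ‖a i‖ ^ 2 - 2 * ⟪∑ i, a i, m⟫ + n * ‖m‖ ^ 2 := by
    simp only [norm_sub_sq_real, Finset.sum_add_distrib, Finset.sum_sub_distrib, sum_inner,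
      Finset.mul_sum]
    simp
  rw [h, hm, real_inner_smul_left, real_inner_self_eq_norm_sq]
  have : 0 ≤ (n : ℝ) * ‖m‖ ^ 2 := by positivity
  linarith

/-- Combined one-step bound for the asynchronous variance-reduced forward step,
with asynchrony error E₀ = 2γ³μτ²M² + 6γ⁴L²τ²M² + 2γ²τM². -/
theorem asynchronous_combined_one_step_bound
    {E : Type*} [NormedAddCommGroup E] [InnerProductSpace ℝ E]
    (n : ℕ) (hn : 1 ≤ n) (μ L γ τ M : ℝ)
    (hμ : 0 < μ) (hL : 0 < L) (hγ : 0 < γ) (hτ : 0 ≤ τ) (hM : 0 ≤ M)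
    (Bi : Fin n → E → E)
    (hlip : ∀ i : Fin n, ∀ x y : E, ‖Bi i x - Bi i y‖ ≤ L * ‖x - y‖)
    (B : E → E) (hB : ∀ x : E, B x = (1 / (n : ℝ)) • ∑ i : Fin n, Bi i x)
    (hmono : ∀ x y : E, μ * ‖x - y‖ ^ 2 ≤ ⟪B x - B y, x - y⟫)
    (xstar : E) (hxstar : B xstar = 0)
    (x xhat : E) (φ φhat : Fin n → E)
    (Ghat : Fin n → E)
    (hGhat : ∀ i : Fin n,
      Ghat i = Bi i xhat - φhat i + (1 / (n : ℝ)) • ∑ j : Fin n, φhat j)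
    (hdelay : ‖xhat - x‖ ≤ γ * τ * M)
    (hGbound : ∀ i : Fin n, ‖Ghat i‖ ≤ M) :
    (1 / (n : ℝ)) * ∑ i : Fin n, ‖(x - γ • Ghat i) - xstar‖ ^ 2 ≤
      (1 - γ * μ + 6 * γ ^ 2 * L ^ 2) * ‖x - xstar‖ ^ 2 +
        (4 * γ ^ 2 / (n : ℝ)) * ∑ i : Fin n, ‖φ i - Bi i xstar‖ ^ 2 +
        (4 * γ ^ 2 / (n : ℝ)) * ∑ i : Fin n, ‖φ i - φhat i‖ ^ 2 +
        2 * γ ^ 3 * μ * τ ^ 2 * M ^ 2 + 6 * γ ^ 4 * L ^ 2 * τ ^ 2 * M ^ 2 +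
        2 * γ ^ 2 * τ * M ^ 2 := by
  have hn0 : (0 : ℝ) < n := by exact_mod_cast hn
  have hsB : ∀ y, ∑ i, Bi i y = (n : ℝ) • B y := by
    intro y
    rw [hB y, smul_smul, mul_one_div_cancel hn0.ne', one_smul]
  set m : E := (1 / (n : ℝ)) • ∑ j : Fin n, φhat j with hmdef
  have hsφ : ∑ j, φhat j = (n : ℝ) • m := by
    rw [hmdef, smul_smul, mul_one_div_cancel hn0.ne', one_smul]
  have hsG : ∑ i, Ghat i = (n : ℝ) • B xhat := by
    simp only [hGhat, Finset.sum_add_distrib, Finset.sum_sub_distrib, hsB, hsφ,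
      Finset.sum_const, Finset.card_univ, Fintype.card_fin, ← Nat.cast_smul_eq_nsmul ℝ]
    abel
  have hBM : ‖B xhat‖ ≤ M := by
    have h1 : ‖∑ i, Ghat i‖ ≤ n * M := by
      refine (norm_sum_le _ _).trans ((Finset.sum_le_sum fun i _ => hGbound i).trans ?_)
      simp
    rw [hsG, norm_smul, Real.norm_of_nonneg hn0.le] at h1
    exact le_of_mul_le_mul_left h1 hn0
  have he2 : ‖xhat - x‖ ^ 2 ≤ (γ * τ * M) ^ 2 := by gcongr
  have hinner : μ * ‖xhat - xstar‖ ^ 2 - M * (γ * τ * M) ≤ ⟪B xhat, x - xstar⟫ := by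
    have h1 := hmono xhat xstar
    rw [hxstar, sub_zero] at h1
    have h2 : ⟪B xhat, x - xstar⟫ = ⟪B xhat, xhat - xstar⟫ - ⟪B xhat, xhat - x⟫ := by
      rw [← inner_sub_right]; congr 1; abel
    have h3 : ⟪B xhat, xhat - x⟫ ≤ M * (γ * τ * M) :=
      (real_inner_le_norm _ _).trans (mul_le_mul hBM hdelay (norm_nonneg _) hM)
    linarith
  have hd : ‖x - xstar‖ ^ 2 ≤ 2 * ‖xhat - xstar‖ ^ 2 + 2 * ‖xhat - x‖ ^ 2 := by
    have := aux_sq_sub (xhat - xstar) (xhat - x)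
    rwa [show xhat - xstar - (xhat - x) = x - xstar by abel] at this
  have hh : ‖xhat - xstar‖ ^ 2 ≤ 2 * ‖x - xstar‖ ^ 2 + 2 * ‖xhat - x‖ ^ 2 := by
    have := aux_sq_add (x - xstar) (xhat - x)
    rwa [show x - xstar + (xhat - x) = xhat - xstar by abel] at this
  have hexp : ∑ i, ‖(x - γ • Ghat i) - xstar‖ ^ 2 =
      n * ‖x - xstar‖ ^ 2 - 2 * γ * (n * ⟪B xhat, x - xstar⟫) + γ ^ 2 * ∑ i, ‖Ghat i‖ ^ 2 := by
    have h1 : ∀ i, ‖(x - γ • Ghat i) - xstar‖ ^ 2 =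
        ‖x - xstar‖ ^ 2 - 2 * γ * ⟪Ghat i, x - xstar⟫ + γ ^ 2 * ‖Ghat i‖ ^ 2 := by
      intro i
      rw [show (x - γ • Ghat i) - xstar = (x - xstar) - γ • Ghat i by abel, norm_sub_sq_real,
        real_inner_smul_right, norm_smul, mul_pow, Real.norm_eq_abs, sq_abs, real_inner_comm]
      ring
    rw [← real_inner_smul_left, ← hsG, sum_inner, Finset.mul_sum, Finset.mul_sum]
    simp only [h1, Finset.sum_add_distrib, Finset.sum_sub_distrib]
    simp
  have hvar : ∑ i, ‖(φhat i - Bi i xstar) - m‖ ^ 2 ≤ ∑ i, ‖φhat i - Bi i xstar‖ ^ 2 := by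
    apply aux_var
    rw [Finset.sum_sub_distrib, hsB, hxstar, hsφ, smul_zero, sub_zero]
  have hφ : ∑ i, ‖φhat i - Bi i xstar‖ ^ 2 ≤
      2 * ∑ i, ‖φ i - Bi i xstar‖ ^ 2 + 2 * ∑ i, ‖φ i - φhat i‖ ^ 2 := by
    rw [Finset.mul_sum, Finset.mul_sum, ← Finset.sum_add_distrib]
    refine Finset.sum_le_sum fun i _ => ?_
    have := aux_sq_sub (φ i - Bi i xstar) (φ i - φhat i)
    rwa [show φ i - Bi i xstar - (φ i - φhat i) = φhat i - Bi i xstar by abel] at this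
  have hG : ∑ i, ‖Ghat i‖ ^ 2 ≤ n * (2 * (L ^ 2 * ‖xhat - xstar‖ ^ 2)) +
      2 * ∑ i, ‖(φhat i - Bi i xstar) - m‖ ^ 2 := by
    have h1 : ∀ i, ‖Ghat i‖ ^ 2 ≤ 2 * (L ^ 2 * ‖xhat - xstar‖ ^ 2) +
        2 * ‖(φhat i - Bi i xstar) - m‖ ^ 2 := by
      intro i
      have h2 := aux_sq_sub (Bi i xhat - Bi i xstar) (φhat i - Bi i xstar - m)
      rw [show Bi i xhat - Bi i xstar - (φhat i - Bi i xstar - m) = Ghat i by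
        rw [hGhat]; abel] at h2
      have h3 : ‖Bi i xhat - Bi i xstar‖ ^ 2 ≤ (L * ‖xhat - xstar‖) ^ 2 := by
        gcongr; exact hlip i _ _
      rw [mul_pow] at h3
      linarith
    refine (Finset.sum_le_sum fun i _ => h1 i).trans ?_
    rw [Finset.sum_add_distrib, Finset.mul_sum]
    simp
  rw [hexp]
  set S := ∑ i, ‖Ghat i‖ ^ 2
  set P := ∑ i, ‖φ i - Bi i xstar‖ ^ 2
  set Q := ∑ i, ‖φ i - φhat i‖ ^ 2
  set I := ⟪B xhat, x - xstar⟫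
  set D := ‖x - xstar‖ ^ 2 with hD
  set H := ‖xhat - xstar‖ ^ 2
  set e := ‖xhat - x‖ ^ 2
  have hD0 : 0 ≤ D := by positivity
  have hS : 1 / (n : ℝ) * S ≤ 2 * (L ^ 2 * H) + 4 / n * P + 4 / n * Q := by
    have h1 : S ≤ n * (2 * (L ^ 2 * H)) + 4 * P + 4 * Q := by linarith
    have h2 := mul_le_mul_of_nonneg_left h1 (by positivity : 0 ≤ 1 / (n : ℝ))
    refine h2.trans (le_of_eq ?_)
    field_simp
  have hHL : L ^ 2 * H ≤ L ^ 2 * (2 * D + 2 * (γ * τ * M) ^ 2) := by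
    gcongr; linarith
  have hLD : 0 ≤ L ^ 2 * D := by positivity
  have hLe : 0 ≤ L ^ 2 * (γ * τ * M) ^ 2 := by positivity
  have hS2 : γ ^ 2 * (1 / (n : ℝ) * S) ≤ γ ^ 2 * (6 * (L ^ 2 * D) +
      6 * (L ^ 2 * (γ * τ * M) ^ 2) + 4 / n * P + 4 / n * Q) := by
    gcongr; linarith
  have hI2 : γ * (μ * H - M * (γ * τ * M)) ≤ γ * I := by gcongr
  have hD2 : γ * μ * D ≤ γ * μ * (2 * H + 2 * (γ * τ * M) ^ 2) := by
    gcongr; linarith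
  have hlhs : 1 / (n : ℝ) * (n * D - 2 * γ * (n * I) + γ ^ 2 * S) =
      D - 2 * (γ * I) + γ ^ 2 * (1 / (n : ℝ) * S) := by
    field_simp
  rw [hlhs]
  have e1 : 4 * γ ^ 2 / (n : ℝ) * P = γ ^ 2 * (4 / n * P) := by ring
  have e2 : 4 * γ ^ 2 / (n : ℝ) * Q = γ ^ 2 * (4 / n * Q) := by ring
  rw [e1, e2]
  linarith
end

section
/- Let μ > 0, L > 0, c₁ ∈ [0, 1), c₂ ≥ 0, c₃ ≥ 0, m̄ ≥ 1, ε_a ≥ 0, ε_g ≥ 0, and suppose γ > 0 satisfies γ < min{ (μ / ((3(1 − c₁)L²)/2 + (1 − c₁)m̄c₃ + c₂))², ((1 − c₁) / (4 + 4m̄((1 − c₁)/4)³c₃))² }. Set ρ = γ^{3/2}, θ = max{1 − γμ + 6γ²L² + c₂ρ, 4γ²/ρ + c₁}, and λ = θ + 4γ²m̄c₃. Let S : ℕ → ℕ be strictly increasing with S(0) = 0 and S(i+1) − S(i) ≤ m̄ for all i. Let a, g, h : ℕ → ℝ be nonnegative sequences such that for all k ≥ 0: a(k+1) ≤ (1 −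 γμ + 6γ²L²)a(k) + 4γ²(g(k) + h(k)) + ε_a and g(k+1) ≤ c₁g(k) + c₂a(k) + ε_g, and such that for every i ≥ 0 and every k with S(i) ≤ k < S(i+1): h(k) ≤ c₃(a(S(i)) + ρg(S(i))). Then 0 ≤ θ < 1, 0 ≤ λ < 1, and for all k ≥ 1, a(S(k)) + ρg(S(k)) ≤ λ(a(S(k−1)) + ρg(S(k−1))) + (ε_a + ρε_g)/(1 − θ). -/
/-- Deterministic-sequence form of the asynchronous convergence theorem:
linear convergence of the Lyapunov values to within E₃/(1−θ) of zero. -/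
theorem asynchronous_lyapunov_convergence
    (μ L c₁ c₂ c₃ mbar γ εa εg ρ θ lam : ℝ)
    (hμ : 0 < μ) (hL : 0 < L) (hc₁0 : 0 ≤ c₁) (hc₁1 : c₁ < 1)
    (hc₂ : 0 ≤ c₂) (hc₃ : 0 ≤ c₃) (hm : 1 ≤ mbar) (hγ : 0 < γ)
    (hεa : 0 ≤ εa) (hεg : 0 ≤ εg)
    (hstep : γ <
      min ((μ / (3 * (1 - c₁) * L ^ 2 / 2 + (1 - c₁) * mbar * c₃ + c₂)) ^ 2)
        (((1 - c₁) / (4 + 4 * mbar * ((1 - c₁) / 4) ^ 3 * c₃)) ^ 2))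
    (hρ : ρ = γ ^ ((3 : ℝ) / 2))
    (hθ : θ = max (1 - γ * μ + 6 * γ ^ 2 * L ^ 2 + c₂ * ρ) (4 * γ ^ 2 / ρ + c₁))
    (hlam : lam = θ + 4 * γ ^ 2 * mbar * c₃)
    (S : ℕ → ℕ) (hS0 : S 0 = 0) (hSmono : StrictMono S)
    (hSlen : ∀ i : ℕ, (S (i + 1) : ℝ) - (S i : ℝ) ≤ mbar)
    (a g h : ℕ → ℝ)
    (ha0 : ∀ k, 0 ≤ a k) (hg0 : ∀ k, 0 ≤ g k) (hh0 : ∀ k, 0 ≤ h k)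
    (harec : ∀ k : ℕ,
      a (k + 1) ≤ (1 - γ * μ + 6 * γ ^ 2 * L ^ 2) * a k + 4 * γ ^ 2 * (g k + h k) + εa)
    (hgrec : ∀ k : ℕ, g (k + 1) ≤ c₁ * g k + c₂ * a k + εg)
    (hhbound : ∀ i k : ℕ, S i ≤ k → k < S (i + 1) →
      h k ≤ c₃ * (a (S i) + ρ * g (S i))) :
    0 ≤ θ ∧ θ < 1 ∧ 0 ≤ lam ∧ lam < 1 ∧
    (∀ k : ℕ, 1 ≤ k →
      a (S k) + ρ * g (S k) ≤
        lam * (a (S (k - 1)) + ρ * g (S (k - 1))) + (εa + ρ * εg) / (1 - θ)) := by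
  obtain ⟨s, hs, rfl⟩ : ∃ s : ℝ, 0 < s ∧ γ = s ^ 2 :=
    ⟨Real.sqrt γ, Real.sqrt_pos.2 hγ, (Real.sq_sqrt hγ.le).symm⟩
  have hρ' : ρ = s ^ 3 := by
    rw [hρ, ← Real.rpow_natCast s 2, ← Real.rpow_mul hs.le, ← Real.rpow_natCast s 3]
    norm_num
  clear hρ
  subst hρ'
  obtain ⟨q, hq⟩ : ∃ q : ℝ, q = (1 - c₁) / 4 := ⟨_, rfl⟩
  have hc1 : c₁ = 1 - 4 * q := by linarith
  have hq0 : 0 < q := by linarith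
  obtain ⟨h1, h2⟩ := lt_min_iff.1 hstep
  rw [← hq] at h2
  have e1 : (1 - c₁) = 4 * q := by linarith
  rw [e1] at h1 h2
  have hmc : 0 ≤ mbar * c₃ := by positivity
  have hD1 : 0 < 3 * (4 * q) * L ^ 2 / 2 + 4 * q * mbar * c₃ + c₂ := by positivity
  have hD2 : 0 < 4 + 4 * mbar * q ^ 3 * c₃ := by positivity
  have h1' := lt_of_pow_lt_pow_left₀ 2 (by positivity) h1
  have h2' := lt_of_pow_lt_pow_left₀ 2 (by positivity) h2
  rw [lt_div_iff₀ hD1] at h1'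
  rw [lt_div_iff₀ hD2] at h2'
  have hsq : s < q := by
    have : 0 ≤ s * (mbar * q ^ 3 * c₃) := by positivity
    linarith
  have hs3 : s ^ 3 ≤ q ^ 3 := by gcongr
  have hdiv : 4 * (s ^ 2) ^ 2 / s ^ 3 = 4 * s := by field_simp
  have hlt1 : 1 - s ^ 2 * μ + 6 * (s ^ 2) ^ 2 * L ^ 2 + c₂ * s ^ 3
      + 4 * (s ^ 2) ^ 2 * mbar * c₃ < 1 := by
    have k1 : s * (6 * s * L ^ 2 + 4 * s * (mbar * c₃) + c₂)
        ≤ s * (6 * q * L ^ 2 + 4 * q * (mbar * c₃) + c₂) := by gcongr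
    have k2 : s * (6 * s * L ^ 2 + 4 * s * (mbar * c₃) + c₂) < μ := by
      refine k1.trans_lt ?_
      linarith
    have k3 := mul_lt_mul_of_pos_left k2 (pow_pos hs 2)
    linarith
  have hlt2 : 4 * (s ^ 2) ^ 2 / s ^ 3 + c₁ + 4 * (s ^ 2) ^ 2 * mbar * c₃ < 1 := by
    rw [hdiv]
    have k1 : s * (4 + 4 * (mbar * c₃) * s ^ 3) ≤ s * (4 + 4 * (mbar * c₃) * q ^ 3) := by
      gcongr
    linarith
  have hB : 0 ≤ 4 * (s ^ 2) ^ 2 * mbar * c₃ := by positivity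
  have hlam1 : lam < 1 := by
    rw [hlam, hθ, ← max_add_add_right]
    exact max_lt hlt1 hlt2
  have hθ1 : θ < 1 := by linarith
  have hA1 : 1 - s ^ 2 * μ + 6 * (s ^ 2) ^ 2 * L ^ 2 + c₂ * s ^ 3 ≤ θ := hθ ▸ le_max_left _ _
  have hA2 : 4 * s + c₁ ≤ θ := by
    rw [← hdiv]
    exact hθ ▸ le_max_right _ _
  have hθ0 : 0 ≤ θ := by linarith
  refine ⟨hθ0, hθ1, by linarith, hlam1, ?_⟩
  have hrec : ∀ k, a (k + 1) + s ^ 3 * g (k + 1) ≤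
      θ * (a k + s ^ 3 * g k) + 4 * (s ^ 2) ^ 2 * h k + (εa + s ^ 3 * εg) := by
    intro k
    have p1 := harec k
    have p2 := mul_le_mul_of_nonneg_left (hgrec k) (pow_pos hs 3).le
    have p3 := mul_le_mul_of_nonneg_right hA1 (ha0 k)
    have p4 := mul_le_mul_of_nonneg_right hA2 (mul_nonneg (pow_pos hs 3).le (hg0 k))
    linarith
  intro k hk
  obtain ⟨i, rfl⟩ : ∃ i, k = i + 1 := ⟨k - 1, by omega⟩
  rw [Nat.add_sub_cancel]
  have hV0 : 0 ≤ a (S i) + s ^ 3 * g (S i) :=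
    add_nonneg (ha0 _) (mul_nonneg (pow_pos hs 3).le (hg0 _))
  have hhb := hhbound i
  generalize hV : a (S i) + s ^ 3 * g (S i) = V at hV0 hhb ⊢
  have hE0 : 0 ≤ εa + s ^ 3 * εg := by positivity
  generalize εa + s ^ 3 * εg = E at hrec hE0 ⊢
  have hF : θ * (E / (1 - θ)) + E = E / (1 - θ) := by
    have : 1 - θ ≠ 0 := by linarith
    field_simp
    ring
  have hF1 : E ≤ E / (1 - θ) := by
    have : 0 ≤ E / (1 - θ) := div_nonneg hE0 (by linarith)
    have := mul_nonneg hθ0 this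
    linarith
  have hC0 : 0 ≤ 4 * (s ^ 2) ^ 2 * (c₃ * V) := by positivity
  have main : ∀ n : ℕ, S i + n < S (i + 1) →
      a (S i + n + 1) + s ^ 3 * g (S i + n + 1) ≤
        θ * V + (n + 1) * (4 * (s ^ 2) ^ 2 * (c₃ * V)) + E / (1 - θ) := by
    intro n
    induction n with
    | zero =>
      intro hn
      have r := hrec (S i)
      have hb := mul_le_mul_of_nonneg_left (hhb (S i) le_rfl hn)
        (by positivity : 0 ≤ 4 * (s ^ 2) ^ 2)
      rw [hV] at r
      simp only [add_zero, Nat.cast_zero, zero_add, one_mul]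
      linarith
    | succ n ih =>
      intro hn
      have ih := mul_le_mul_of_nonneg_left (ih (by omega)) hθ0
      have r := hrec (S i + n + 1)
      have hb := mul_le_mul_of_nonneg_left (hhb (S i + n + 1) (by omega) (by omega))
        (by positivity : 0 ≤ 4 * (s ^ 2) ^ 2)
      have t1 : θ * (θ * V) ≤ θ * V := mul_le_of_le_one_left (by positivity) hθ1.le
      have t2 : θ * (((n : ℝ) + 1) * (4 * (s ^ 2) ^ 2 * (c₃ * V)))
          ≤ ((n : ℝ) + 1) * (4 * (s ^ 2) ^ 2 * (c₃ * V)) :=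
        mul_le_of_le_one_left (by positivity) hθ1.le
      rw [← add_assoc (S i) n 1]
      push_cast
      linarith
  have hSi : S i < S (i + 1) := hSmono (Nat.lt_succ_self i)
  obtain ⟨n, hn⟩ : ∃ n, S (i + 1) = S i + n + 1 := ⟨S (i + 1) - S i - 1, by omega⟩
  have hfin := main n (by omega)
  have hl := hSlen i
  rw [hn] at hl ⊢
  push_cast at hl
  have hl' : (n : ℝ) + 1 ≤ mbar := by linarith
  have := mul_le_mul_of_nonneg_right hl' hC0
  rw [hlam]
  linarith
end

section
/- Let E be a real inner product space, let n ≥ 1 and L > 0, let B₁, …, Bₙ : E → E each be L-Lipschitz, and let x, x* ∈ E and φ₁, …, φₙ ∈ E. For each index i', let φ^{(i')} denote φ with its i'-th coordinate replaced by B_{i'}(x) (the SAGA proxy update), and set G(ψ) = (1/n)∑_{i=1}^n ‖ψᵢ − Bᵢ(x*)‖². Then (1/n)∑_{i'=1}^n G(φ^{(i')}) = (1 − 1/n)G(φ) + (1/n²)∑_{i=1}^n ‖Bᵢ(x) − Bᵢ(x*)‖² ≤ (1 − 1/n)G(φ) + (L²/n)‖x − x*‖². -/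
/-- Expected proxy-error recursion for the SAGA update: averaging over the
uniformly sampled coordinate that gets replaced by the current evaluation. -/
theorem saga_proxy_error_recursion
    {E : Type*} [NormedAddCommGroup E] [InnerProductSpace ℝ E]
    (n : ℕ) (hn : 1 ≤ n) (L : ℝ) (hL : 0 < L)
    (Bi : Fin n → E → E)
    (hlip : ∀ i : Fin n, ∀ x y : E, ‖Bi i x - Bi i y‖ ≤ L * ‖x - y‖)
    (x xstar : E) (φ : Fin n → E)
    (G : (Fin n → E) → ℝ)
    (hG : ∀ ψ : Fin n → E, G ψ = (1 / (n : ℝ)) * ∑ i : Fin n, ‖ψ i - Bi i xstar‖ ^ 2) :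
    (1 / (n : ℝ)) * ∑ i' : Fin n, G (Function.update φ i' (Bi i' x)) =
        (1 - 1 / (n : ℝ)) * G φ +
          (1 / (n : ℝ) ^ 2) * ∑ i : Fin n, ‖Bi i x - Bi i xstar‖ ^ 2 ∧
    (1 / (n : ℝ)) * ∑ i' : Fin n, G (Function.update φ i' (Bi i' x)) ≤
        (1 - 1 / (n : ℝ)) * G φ + (L ^ 2 / (n : ℝ)) * ‖x - xstar‖ ^ 2 := by
  have hn0 : (n : ℝ) ≠ 0 := by
    have : n ≠ 0 := by omega
    exact_mod_cast this
  have hnpos : (0 : ℝ) < n := by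
    have : 0 < n := by omega
    exact_mod_cast this
  have key : ∀ i' : Fin n, G (Function.update φ i' (Bi i' x)) =
      (1 / (n : ℝ)) * (∑ i : Fin n, ‖φ i - Bi i xstar‖ ^ 2
        + (‖Bi i' x - Bi i' xstar‖ ^ 2 - ‖φ i' - Bi i' xstar‖ ^ 2)) := by
    intro i'
    rw [hG]
    congr 1
    rw [← Finset.add_sum_erase Finset.univ _ (Finset.mem_univ i'),
      ← Finset.add_sum_erase Finset.univ (fun i => ‖φ i - Bi i xstar‖ ^ 2)
        (Finset.mem_univ i')]
    have h : ∑ i ∈ Finset.univ.erase i',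
        ‖Function.update φ i' (Bi i' x) i - Bi i xstar‖ ^ 2
        = ∑ i ∈ Finset.univ.erase i', ‖φ i - Bi i xstar‖ ^ 2 := by
      refine Finset.sum_congr rfl fun i hi => ?_
      rw [Function.update_of_ne (Finset.ne_of_mem_erase hi)]
    rw [h, Function.update_self]
    ring
  have eq1 : (1 / (n : ℝ)) * ∑ i' : Fin n, G (Function.update φ i' (Bi i' x)) =
        (1 - 1 / (n : ℝ)) * G φ +
          (1 / (n : ℝ) ^ 2) * ∑ i : Fin n, ‖Bi i x - Bi i xstar‖ ^ 2 := by
    rw [Finset.sum_congr rfl fun i' _ => key i', ← Finset.mul_sum, Finset.sum_add_distrib,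
      Finset.sum_sub_distrib, hG φ, Finset.sum_const, Finset.card_univ, Fintype.card_fin,
      nsmul_eq_mul]
    field_simp
    ring
  refine ⟨eq1, ?_⟩
  rw [eq1]
  have hs : ∑ i : Fin n, ‖Bi i x - Bi i xstar‖ ^ 2 ≤ n * (L * ‖x - xstar‖) ^ 2 := by
    calc _ ≤ ∑ _i : Fin n, (L * ‖x - xstar‖) ^ 2 :=
          Finset.sum_le_sum fun i _ => pow_le_pow_left₀ (norm_nonneg _) (hlip i x xstar) 2
      _ = _ := by simp
  have h2 : (1 / (n : ℝ) ^ 2) * ∑ i : Fin n, ‖Bi i x - Bi i xstar‖ ^ 2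
      ≤ (L ^ 2 / (n : ℝ)) * ‖x - xstar‖ ^ 2 := by
    calc _ ≤ (1 / (n : ℝ) ^ 2) * (n * (L * ‖x - xstar‖) ^ 2) :=
          mul_le_mul_of_nonneg_left hs (by positivity)
      _ = _ := by field_simp
  linarith
end

section
/- Let E be a real inner product space, let n ≥ 1 and L > 0, let B₁, …, Bₙ : E → E each be L-Lipschitz, let x, x* ∈ E and φ₁, …, φₙ ∈ E, and let q ∈ [0, 1]. For each index i', let φ^{(i')} denote φ with its i'-th coordinate replaced by B_{i'}(x), let φ^{full} denote the proxy vector with φ^{full}ᵢ = Bᵢ(x) for all i, and set G(ψ) = (1/n)∑_{i=1}^n ‖ψᵢ − Bᵢ(x*)‖². Then q · G(φ^{full}) + (1 − q) · (1/n)∑_{i'=1}^n G(φ^{(i')}) = (q + (1 − q)/n) · (1/n)∑_{i=1}^n ‖Bᵢ(x) − Bᵢ(x*)‖² + (1 − q)(1 − 1/n)G(φ) ≤ (1 − q)(1 − 1/n)G(φ) + (q + (1 − q)/n)L²‖x − x*‖². -/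
/-- Expected proxy-error recursion for the SAGD update: full refresh with
probability q, SAGA single-coordinate update with probability 1 − q. -/
theorem sagd_proxy_error_recursion
    {E : Type*} [NormedAddCommGroup E] [InnerProductSpace ℝ E]
    (n : ℕ) (hn : 1 ≤ n) (L : ℝ) (hL : 0 < L)
    (Bi : Fin n → E → E)
    (hlip : ∀ i : Fin n, ∀ x y : E, ‖Bi i x - Bi i y‖ ≤ L * ‖x - y‖)
    (x xstar : E) (φ : Fin n → E)
    (q : ℝ) (hq0 : 0 ≤ q) (hq1 : q ≤ 1)
    (G : (Fin n → E) → ℝ)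
    (hG : ∀ ψ : Fin n → E, G ψ = (1 / (n : ℝ)) * ∑ i : Fin n, ‖ψ i - Bi i xstar‖ ^ 2) :
    q * G (fun i => Bi i x) +
        (1 - q) * ((1 / (n : ℝ)) * ∑ i' : Fin n, G (Function.update φ i' (Bi i' x))) =
      (q + (1 - q) / (n : ℝ)) *
          ((1 / (n : ℝ)) * ∑ i : Fin n, ‖Bi i x - Bi i xstar‖ ^ 2) +
        (1 - q) * (1 - 1 / (n : ℝ)) * G φ ∧
    q * G (fun i => Bi i x) +
        (1 - q) * ((1 / (n : ℝ)) * ∑ i' : Fin n, G (Function.update φ i' (Bi i' x))) ≤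
      (1 - q) * (1 - 1 / (n : ℝ)) * G φ +
        (q + (1 - q) / (n : ℝ)) * L ^ 2 * ‖x - xstar‖ ^ 2 := by
  have hn0 : (0 : ℝ) < n := by exact_mod_cast hn
  have hn1 : (n : ℝ) ≠ 0 := hn0.ne'
  have hterm : ∀ i' : Fin n, G (Function.update φ i' (Bi i' x)) =
      G φ + (1 / (n : ℝ)) * (‖Bi i' x - Bi i' xstar‖ ^ 2 - ‖φ i' - Bi i' xstar‖ ^ 2) := by
    intro i'
    have hs : ∑ i : Fin n, (‖Function.update φ i' (Bi i' x) i - Bi i xstar‖ ^ 2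
        - ‖φ i - Bi i xstar‖ ^ 2) =
        ‖Bi i' x - Bi i' xstar‖ ^ 2 - ‖φ i' - Bi i' xstar‖ ^ 2 := by
      rw [Finset.sum_eq_single i']
      · simp
      · intro b _ hb
        simp [Function.update_of_ne hb]
      · simp
    rw [hG, hG, ← hs, Finset.sum_sub_distrib]
    ring
  have heq : q * G (fun i => Bi i x) +
        (1 - q) * ((1 / (n : ℝ)) * ∑ i' : Fin n, G (Function.update φ i' (Bi i' x))) =
      (q + (1 - q) / (n : ℝ)) *
          ((1 / (n : ℝ)) * ∑ i : Fin n, ‖Bi i x - Bi i xstar‖ ^ 2) +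
        (1 - q) * (1 - 1 / (n : ℝ)) * G φ := by
    simp only [hterm]
    rw [Finset.sum_add_distrib, ← Finset.mul_sum, Finset.sum_sub_distrib, hG, hG φ]
    simp only [Finset.sum_const, Finset.card_univ, Fintype.card_fin, nsmul_eq_mul]
    field_simp
    ring
  refine ⟨heq, ?_⟩
  rw [heq]
  have hb : (1 / (n : ℝ)) * ∑ i : Fin n, ‖Bi i x - Bi i xstar‖ ^ 2 ≤ L ^ 2 * ‖x - xstar‖ ^ 2 := by
    have h1 : ∑ i : Fin n, ‖Bi i x - Bi i xstar‖ ^ 2 ≤ ∑ _i : Fin n, L ^ 2 * ‖x - xstar‖ ^ 2 := by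
      apply Finset.sum_le_sum
      intro i _
      rw [← mul_pow]
      exact pow_le_pow_left₀ (norm_nonneg _) (hlip i x xstar) 2
    simp only [Finset.sum_const, Finset.card_univ, Fintype.card_fin, nsmul_eq_mul] at h1
    rw [one_div, inv_mul_le_iff₀ hn0]
    exact h1
  have hc : 0 ≤ q + (1 - q) / (n : ℝ) := add_nonneg hq0 (div_nonneg (by linarith) hn0.le)
  have := mul_le_mul_of_nonneg_left hb hc
  linarith
end

section
/- Let E be a real inner product space, let n ≥ 1 and L > 0, let B₁, …, Bₙ : E → E each be L-Lipschitz, let x, x* ∈ E and φ₁, …, φₙ ∈ E, and let S ⊆ {1,…,n} with cardinality |S|. For each index i', let φ^{(i')} denote φ with its i'-th coordinate replaced by B_{i'}(x), and set G_S(ψ) = (1/n)∑_{i∈S} ‖ψᵢ − Bᵢ(x*)‖². Then (1/n)∑_{i'=1}^n G_S(φ^{(i')}) = (1 − 1/n)G_S(φ) + (1/n²)∑_{i∈S} ‖Bᵢ(x) − Bᵢ(x*)‖² ≤ (1 − 1/n)G_S(φ) + (|S|L²/n²)‖x − x*‖². -/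
/-- Expected proxy-error recursion, over the SAGA-updated index set S, for the
HSAG update scheme. -/
theorem hsag_proxy_error_recursion
    {E : Type*} [NormedAddCommGroup E] [InnerProductSpace ℝ E]
    (n : ℕ) (hn : 1 ≤ n) (L : ℝ) (hL : 0 < L)
    (Bi : Fin n → E → E)
    (hlip : ∀ i : Fin n, ∀ x y : E, ‖Bi i x - Bi i y‖ ≤ L * ‖x - y‖)
    (x xstar : E) (φ : Fin n → E)
    (S : Finset (Fin n))
    (GS : (Fin n → E) → ℝ)
    (hGS : ∀ ψ : Fin n → E, GS ψ = (1 / (n : ℝ)) * ∑ i ∈ S, ‖ψ i - Bi i xstar‖ ^ 2) :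
    (1 / (n : ℝ)) * ∑ i' : Fin n, GS (Function.update φ i' (Bi i' x)) =
        (1 - 1 / (n : ℝ)) * GS φ +
          (1 / (n : ℝ) ^ 2) * ∑ i ∈ S, ‖Bi i x - Bi i xstar‖ ^ 2 ∧
    (1 / (n : ℝ)) * ∑ i' : Fin n, GS (Function.update φ i' (Bi i' x)) ≤
        (1 - 1 / (n : ℝ)) * GS φ +
          ((S.card : ℝ) * L ^ 2 / (n : ℝ) ^ 2) * ‖x - xstar‖ ^ 2 := by
  have hn0 : (n : ℝ) ≠ 0 := by
    have : n ≠ 0 := by omega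
    exact_mod_cast this
  have hpt : ∀ i : Fin n, ∑ i' : Fin n,
      ‖Function.update φ i' (Bi i' x) i - Bi i xstar‖ ^ 2 =
      ((n : ℝ) - 1) * ‖φ i - Bi i xstar‖ ^ 2 + ‖Bi i x - Bi i xstar‖ ^ 2 := by
    intro i
    have h : ∀ i' : Fin n, ‖Function.update φ i' (Bi i' x) i - Bi i xstar‖ ^ 2 =
        ‖φ i - Bi i xstar‖ ^ 2 +
          (if i = i' then ‖Bi i x - Bi i xstar‖ ^ 2 - ‖φ i - Bi i xstar‖ ^ 2 else 0) := by
      intro i'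
      by_cases hi : i = i'
      · subst hi
        simp
      · simp [Function.update_of_ne hi, hi]
    rw [Finset.sum_congr rfl (fun i' _ => h i'), Finset.sum_add_distrib, Finset.sum_ite_eq]
    simp
    ring
  have heq : (1 / (n : ℝ)) * ∑ i' : Fin n, GS (Function.update φ i' (Bi i' x)) =
        (1 - 1 / (n : ℝ)) * GS φ +
          (1 / (n : ℝ) ^ 2) * ∑ i ∈ S, ‖Bi i x - Bi i xstar‖ ^ 2 := by
    simp only [hGS]
    rw [← Finset.mul_sum, Finset.sum_comm, Finset.sum_congr rfl (fun i _ => hpt i),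
      Finset.sum_add_distrib, ← Finset.mul_sum]
    field_simp
  refine ⟨heq, ?_⟩
  rw [heq]
  have hb : ∑ i ∈ S, ‖Bi i x - Bi i xstar‖ ^ 2 ≤ (S.card : ℝ) * (L * ‖x - xstar‖) ^ 2 := by
    rw [← nsmul_eq_mul]
    apply Finset.sum_le_card_nsmul
    intro i _
    exact pow_le_pow_left₀ (norm_nonneg _) (hlip i x xstar) 2
  have h2 := mul_le_mul_of_nonneg_left hb (by positivity : (0 : ℝ) ≤ 1 / (n : ℝ) ^ 2)
  have h3 : 1 / (n : ℝ) ^ 2 * ((S.card : ℝ) * (L * ‖x - xstar‖) ^ 2) =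
      ((S.card : ℝ) * L ^ 2 / (n : ℝ) ^ 2) * ‖x - xstar‖ ^ 2 := by ring
  linarith
end

section
/- Let E be a real inner product space, let n ≥ 1 and L > 0, let B₁, …, Bₙ : E → E each be L-Lipschitz, let x, x* ∈ E and φ₁, …, φₙ ∈ E, and let S₁, S₂ partition {1,…,n} with cardinalities |S₁| and |S₂|. For each index i', let φ^{(i')} denote φ with its i'-th coordinate replaced by B_{i'}(x); set G_{S₁}(ψ) = (1/n)∑_{i∈S₁} ‖ψᵢ − Bᵢ(x*)‖² and G_{S₂}(ψ) = (1/n)∑_{i∈S₂} ‖ψᵢ − Bᵢ(x*)‖². If 0 < p̲ ≤ p ≤ p̄ ≤ 1, then (1/n)∑_{i'=1}^n G_{S₁}(φ^{(i')}) + p · (1/n)∑_{i∈S₂} ‖Bᵢ(x) − Bᵢ(x*)‖² + (1 − p) · G_{S₂}(φ) ≤ max{1 − 1/n, 1 − p̲} · (G_{S₁}(φ) + G_{S₂}(φ)) + (|S₁|L²/n² + p̄|S₂|L²/n)‖x − x*‖². -/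
/-- Expected proxy-error recursion for the hybrid SAGA+SVRG-rand update:
proxies in S₁ follow SAGA updates, proxies in S₂ follow SVRG-rand updates. -/
theorem saga_svrg_rand_proxy_error_recursion
    {E : Type*} [NormedAddCommGroup E] [InnerProductSpace ℝ E]
    (n : ℕ) (hn : 1 ≤ n) (L : ℝ) (hL : 0 < L)
    (Bi : Fin n → E → E)
    (hlip : ∀ i : Fin n, ∀ x y : E, ‖Bi i x - Bi i y‖ ≤ L * ‖x - y‖)
    (x xstar : E) (φ : Fin n → E)
    (S₁ S₂ : Finset (Fin n))
    (hunion : S₁ ∪ S₂ = Finset.univ) (hdisj : Disjoint S₁ S₂)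
    (GS₁ GS₂ : (Fin n → E) → ℝ)
    (hGS₁ : ∀ ψ : Fin n → E, GS₁ ψ = (1 / (n : ℝ)) * ∑ i ∈ S₁, ‖ψ i - Bi i xstar‖ ^ 2)
    (hGS₂ : ∀ ψ : Fin n → E, GS₂ ψ = (1 / (n : ℝ)) * ∑ i ∈ S₂, ‖ψ i - Bi i xstar‖ ^ 2)
    (p plow phigh : ℝ)
    (hplow : 0 < plow) (hlp : plow ≤ p) (hpu : p ≤ phigh) (hphigh : phigh ≤ 1) :
    (1 / (n : ℝ)) * ∑ i' : Fin n, GS₁ (Function.update φ i' (Bi i' x)) +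
        p * ((1 / (n : ℝ)) * ∑ i ∈ S₂, ‖Bi i x - Bi i xstar‖ ^ 2) +
        (1 - p) * GS₂ φ ≤
      max (1 - 1 / (n : ℝ)) (1 - plow) * (GS₁ φ + GS₂ φ) +
        ((S₁.card : ℝ) * L ^ 2 / (n : ℝ) ^ 2 +
          phigh * (S₂.card : ℝ) * L ^ 2 / (n : ℝ)) * ‖x - xstar‖ ^ 2 := by
  have hn0 : (0 : ℝ) < n := by exact_mod_cast hn
  have hlip2 : ∀ i, ‖Bi i x - Bi i xstar‖ ^ 2 ≤ L ^ 2 * ‖x - xstar‖ ^ 2 := by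
    intro i
    rw [← mul_pow]
    exact pow_le_pow_left₀ (norm_nonneg _) (hlip i x xstar) 2
  have hbound : ∀ S : Finset (Fin n), ∑ i ∈ S, ‖Bi i x - Bi i xstar‖ ^ 2
      ≤ (S.card : ℝ) * (L ^ 2 * ‖x - xstar‖ ^ 2) := by
    intro S
    have h := Finset.sum_le_card_nsmul S _ _ (fun i _ => hlip2 i)
    rwa [nsmul_eq_mul] at h
  have hpt : ∀ i' i : Fin n, ‖Function.update φ i' (Bi i' x) i - Bi i xstar‖ ^ 2
      = ‖φ i - Bi i xstar‖ ^ 2 +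
        (if i' = i then ‖Bi i x - Bi i xstar‖ ^ 2 - ‖φ i - Bi i xstar‖ ^ 2 else 0) := by
    intro i' i
    by_cases h : i' = i
    · subst h
      simp
    · rw [Function.update_of_ne (Ne.symm h)]
      simp [h]
  have hsum : ∑ i' : Fin n, GS₁ (Function.update φ i' (Bi i' x)) =
      (1 / (n : ℝ)) * ((n : ℝ) * ∑ i ∈ S₁, ‖φ i - Bi i xstar‖ ^ 2 +
        (∑ i ∈ S₁, ‖Bi i x - Bi i xstar‖ ^ 2 - ∑ i ∈ S₁, ‖φ i - Bi i xstar‖ ^ 2)) := by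
    simp only [hGS₁]
    rw [← Finset.mul_sum, Finset.sum_comm]
    simp only [hpt, Finset.sum_add_distrib, Finset.sum_ite_eq', Finset.mem_univ, if_true,
      Finset.sum_const, Finset.card_univ, Fintype.card_fin, nsmul_eq_mul,
      Finset.sum_sub_distrib, Finset.mul_sum]
  rw [hsum, hGS₁, hGS₂]
  have hA1 : 0 ≤ ∑ i ∈ S₁, ‖φ i - Bi i xstar‖ ^ 2 := Finset.sum_nonneg fun i _ => sq_nonneg _
  have hA2 : 0 ≤ ∑ i ∈ S₂, ‖φ i - Bi i xstar‖ ^ 2 := Finset.sum_nonneg fun i _ => sq_nonneg _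
  have hB2 : 0 ≤ ∑ i ∈ S₂, ‖Bi i x - Bi i xstar‖ ^ 2 := Finset.sum_nonneg fun i _ => sq_nonneg _
  have hb1 := hbound S₁
  have hb2 := hbound S₂
  generalize ∑ i ∈ S₁, ‖φ i - Bi i xstar‖ ^ 2 = A1 at *
  generalize ∑ i ∈ S₂, ‖φ i - Bi i xstar‖ ^ 2 = A2 at *
  generalize ∑ i ∈ S₁, ‖Bi i x - Bi i xstar‖ ^ 2 = B1 at *
  generalize ∑ i ∈ S₂, ‖Bi i x - Bi i xstar‖ ^ 2 = B2 at *
  have hm1 := le_max_left (1 - 1 / (n : ℝ)) (1 - plow)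
  have hm2 := le_max_right (1 - 1 / (n : ℝ)) (1 - plow)
  generalize max (1 - 1 / (n : ℝ)) (1 - plow) = M at *
  have hi : 0 ≤ 1 / (n : ℝ) := by positivity
  have e1 : (1 - 1 / (n : ℝ)) * (1 / n * A1) ≤ M * (1 / n * A1) :=
    mul_le_mul_of_nonneg_right hm1 (mul_nonneg hi hA1)
  have e2 : (1 - p) * (1 / n * A2) ≤ M * (1 / n * A2) :=
    mul_le_mul_of_nonneg_right (by linarith) (mul_nonneg hi hA2)
  have e3 : 1 / (n : ℝ) * (1 / n * B1) ≤ 1 / (n : ℝ) * (1 / n * (S₁.card * (L ^ 2 * ‖x - xstar‖ ^ 2))) := by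
    gcongr
  have e4 : p * (1 / n * B2) ≤ phigh * (1 / n * (S₂.card * (L ^ 2 * ‖x - xstar‖ ^ 2))) := by
    have : 0 ≤ phigh := by linarith
    gcongr
  have e5 : 1 / (n : ℝ) * (1 / n * (n * A1 + (B1 - A1)))
      = (1 - 1 / (n : ℝ)) * (1 / n * A1) + 1 / (n : ℝ) * (1 / n * B1) := by
    field_simp
    ring
  have e6 : ((S₁.card : ℝ) * L ^ 2 / (n : ℝ) ^ 2 +
          phigh * (S₂.card : ℝ) * L ^ 2 / (n : ℝ)) * ‖x - xstar‖ ^ 2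
      = 1 / (n : ℝ) * (1 / n * (S₁.card * (L ^ 2 * ‖x - xstar‖ ^ 2))) +
        phigh * (1 / n * (S₂.card * (L ^ 2 * ‖x - xstar‖ ^ 2))) := by
    field_simp
  rw [e5, e6, mul_add]
  linarith
end

section
/- Let E be a real inner product space, let n ≥ 1, μ > 0, L > 0, γ > 0. Let B₁, …, Bₙ : E → E each be L-Lipschitz, and let B = (1/n)∑_{i=1}^n Bᵢ be μ-strongly monotone. Let v, y ∈ E and set y' = y − γ • v. Then (1/n)∑_{i=1}^n ‖Bᵢ(y') − Bᵢ(y) + v‖² ≤ (1 − 2γμ + γ²L²)‖v‖². -/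
open scoped RealInnerProductSpace

/-- The second moment of the SARAH recursive estimator contracts by the factor
1 − 2γμ + γ²L² at each inner iteration. -/
theorem sarah_estimator_contraction
    {E : Type*} [NormedAddCommGroup E] [InnerProductSpace ℝ E]
    (n : ℕ) (hn : 1 ≤ n) (μ L γ : ℝ) (hμ : 0 < μ) (hL : 0 < L) (hγ : 0 < γ)
    (Bi : Fin n → E → E)
    (hlip : ∀ i : Fin n, ∀ x y : E, ‖Bi i x - Bi i y‖ ≤ L * ‖x - y‖)
    (B : E → E) (hB : ∀ x : E, B x = (1 / (n : ℝ)) • ∑ i : Fin n, Bi i x)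
    (hmono : ∀ x y : E, μ * ‖x - y‖ ^ 2 ≤ ⟪B x - B y, x - y⟫)
    (v y : E) :
    (1 / (n : ℝ)) * ∑ i : Fin n, ‖Bi i (y - γ • v) - Bi i y + v‖ ^ 2 ≤
      (1 - 2 * γ * μ + γ ^ 2 * L ^ 2) * ‖v‖ ^ 2 := by
  have hn' : (0 : ℝ) < n := by exact_mod_cast hn
  have hsub : y - γ • v - y = -(γ • v) := by abel
  have hnorm : ‖y - γ • v - y‖ = γ * ‖v‖ := by
    rw [hsub, norm_neg, norm_smul, Real.norm_of_nonneg hγ.le]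
  have hm := hmono (y - γ • v) y
  rw [hnorm, hsub, inner_neg_right, inner_smul_right] at hm
  have hm2 : ⟪B (y - γ • v) - B y, v⟫ ≤ -(μ * γ * ‖v‖ ^ 2) := by
    refine le_of_mul_le_mul_left ?_ hγ
    linarith
  have hD : ⟪B (y - γ • v) - B y, v⟫
      = (1 / (n : ℝ)) * ∑ i : Fin n, ⟪Bi i (y - γ • v) - Bi i y, v⟫ := by
    rw [hB, hB, ← smul_sub, ← Finset.sum_sub_distrib, real_inner_smul_left, sum_inner]
  have hi : ∀ i : Fin n, ‖Bi i (y - γ • v) - Bi i y + v‖ ^ 2 ≤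
      2 * ⟪Bi i (y - γ • v) - Bi i y, v⟫ + (1 + γ ^ 2 * L ^ 2) * ‖v‖ ^ 2 := by
    intro i
    have h := hlip i (y - γ • v) y
    rw [hnorm] at h
    have h2 := pow_le_pow_left₀ (norm_nonneg _) h 2
    rw [norm_add_sq_real]
    linarith
  have hs := Finset.sum_le_sum (fun i (_ : i ∈ Finset.univ) => hi i)
  rw [Finset.sum_add_distrib, ← Finset.mul_sum, Finset.sum_const, Finset.card_univ,
    Fintype.card_fin, nsmul_eq_mul] at hs
  have hs2 := mul_le_mul_of_nonneg_left hs (one_div_pos.mpr hn').le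
  have e : (1 / (n : ℝ)) * ((n : ℝ) * ((1 + γ ^ 2 * L ^ 2) * ‖v‖ ^ 2))
      = (1 + γ ^ 2 * L ^ 2) * ‖v‖ ^ 2 := by
    field_simp
  rw [mul_add, e, mul_left_comm, ← hD] at hs2
  linarith
end
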